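/- arXiv:1206.2459 — 3 statements merged into one kernel-verified Lean document; each statement's English description precedes it below -/
import Mathlib

section
/- (Pythagorean inequality.) Let α ∈ (0,∞), let 𝒟 be an α-convex set of probability distributions on a measurable space (X, 𝓐), and let Q be an arbitrary probability distribution on (X, 𝓐). If the α-information projection P* exists, i.e. P* ∈ 𝒟 attains the infimum inf_{P∈𝒟} D_α(P‖Q), then D_α(P‖Q) ≥ D_α(P‖P*) + D_α(P*‖Q) for all P ∈ 𝒟. -/
open MeasureTheory Real Filter Set
open scoped ENNReal NNReal Topology Classical

/-- The Hellinger integral `∫ p^α q^(1-α) dμ`, computed with the dominating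
measure `μ = P + Q` (the value does not depend on the choice of dominating
measure). The `ℝ≥0∞`-valued `rpow` automatically implements the conventions
`0/0 = 0` and `x/0 = ∞` for `x > 0` when `α > 1`. -/
noncomputable def hellingerInt {X : Type*} [MeasurableSpace X]
    (α : ℝ) (P Q : Measure X) : ℝ≥0∞ :=
  ∫⁻ x, P.rnDeriv (P + Q) x ^ α * Q.rnDeriv (P + Q) x ^ (1 - α) ∂(P + Q)

/-- Rényi divergence of a simple order `α ∈ (0,1) ∪ (1,∞)`:
`D_α(P‖Q) = (α-1)⁻¹ log ∫ p^α q^(1-α) dμ`. -/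
noncomputable def renyiSimple {X : Type*} [MeasurableSpace X]
    (α : ℝ) (P Q : Measure X) : EReal :=
  (((α - 1)⁻¹ : ℝ) : EReal) * ENNReal.log (hellingerInt α P Q)

/-- Rényi divergence of any order `α ∈ [0,∞]`.  The extended orders `0`, `1`, `∞`
are defined as the limits of the simple orders (the limits exist by monotonicity
in the order, so they coincide with the `limsup`s used here). -/
noncomputable def renyiDiv {X : Type*} [MeasurableSpace X]
    (α : ℝ≥0∞) (P Q : Measure X) : EReal :=
  if α = 0 then Filter.limsup (fun a : ℝ => renyiSimple a P Q) (nhdsWithin (0:ℝ) (Set.Ioi 0))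
  else if α = 1 then Filter.limsup (fun a : ℝ => renyiSimple a P Q) (nhdsWithin (1:ℝ) (Set.Iio 1))
  else if α = ∞ then Filter.limsup (fun a : ℝ => renyiSimple a P Q) Filter.atTop
  else renyiSimple α.toReal P Q

/-- Kullback-Leibler divergence `D(P‖Q) = ∫ p log (p/q) dμ`, with the conventions
`0 log (0/q) = 0` and `p log (p/0) = ∞` for `p > 0`; in particular `D(P‖Q) = ∞`
whenever `P` is not absolutely continuous w.r.t. `Q`, or the integral diverges. -/
noncomputable def klDiv {X : Type*} [MeasurableSpace X] (P Q : Measure X) : EReal :=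
  if P ≪ Q ∧ Integrable (llr P Q) P then ((∫ x, llr P Q x ∂P : ℝ) : EReal) else ⊤

/-- The `(α,λ)`-mixture of `P₁` and `P₂` with weights `l₁, l₂`: the probability
distribution with density proportional to `(l₁ p₁^α + l₂ p₂^α)^(1/α)` (computed here
with respect to the dominating measure `P₁ + P₂`). -/
noncomputable def alphaMix {X : Type*} [MeasurableSpace X]
    (α : ℝ) (l₁ l₂ : ℝ≥0∞) (P₁ P₂ : Measure X) : Measure X :=
  (∫⁻ x, (l₁ * P₁.rnDeriv (P₁ + P₂) x ^ α + l₂ * P₂.rnDeriv (P₁ + P₂) x ^ α) ^ (1/α)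
      ∂(P₁ + P₂))⁻¹ •
    (P₁ + P₂).withDensity
      (fun x => (l₁ * P₁.rnDeriv (P₁ + P₂) x ^ α + l₂ * P₂.rnDeriv (P₁ + P₂) x ^ α) ^ (1/α))

/-- A set of distributions is `α`-convex if it is closed under taking `(α,λ)`-mixtures. -/
def AlphaConvex {X : Type*} [MeasurableSpace X] (α : ℝ) (S : Set (Measure X)) : Prop :=
  ∀ l₁ l₂ : ℝ≥0∞, l₁ + l₂ = 1 → ∀ P₁ ∈ S, ∀ P₂ ∈ S, alphaMix α l₁ l₂ P₁ P₂ ∈ S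

lemma exists_dens {X : Type*} [MeasurableSpace X] (P μ : Measure X) [IsFiniteMeasure P]
    [SigmaFinite μ] (h : P ≪ μ) :
    ∃ p : X → ℝ≥0, Measurable p ∧ P = μ.withDensity (fun x => (p x : ℝ≥0∞)) := by
  refine ⟨fun x => (P.rnDeriv μ x).toNNReal, (Measure.measurable_rnDeriv P μ).ennreal_toNNReal, ?_⟩
  conv_lhs => rw [← Measure.withDensity_rnDeriv_eq P μ h]
  apply withDensity_congr_ae
  filter_upwards [Measure.rnDeriv_lt_top P μ] with x hx
  rw [ENNReal.coe_toNNReal hx.ne]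

lemma dens_eq {X : Type*} [MeasurableSpace X] (μ : Measure X) [SigmaFinite μ] (P Q : Measure X)
    [IsFiniteMeasure P] [IsFiniteMeasure Q]
    (p w : X → ℝ≥0) (hp : Measurable p) (hw : Measurable w)
    (hP : P = μ.withDensity (fun x => (p x : ℝ≥0∞)))
    (hQ : Q = μ.withDensity (fun x => (w x : ℝ≥0∞))) (hPQ : P ≪ Q) :
    ∀ᵐ x ∂μ, (p x : ℝ≥0∞) = w x * P.rnDeriv Q x := by
  have h1 := Measure.withDensity_rnDeriv_eq P Q hPQ
  have h2 : μ.withDensity (fun x => (p x : ℝ≥0∞)) =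
      μ.withDensity ((fun x => (w x : ℝ≥0∞)) * P.rnDeriv Q) := by
    rw [withDensity_mul _ hw.coe_nnreal_ennreal (Measure.measurable_rnDeriv P Q), ← hQ, h1, hP]
  exact (withDensity_eq_iff_of_sigmaFinite hp.coe_nnreal_ennreal.aemeasurable
    ((hw.coe_nnreal_ennreal.mul (Measure.measurable_rnDeriv P Q)).aemeasurable)).1 h2

lemma add_dens {X : Type*} [MeasurableSpace X] (μ : Measure X) (P Q : Measure X)
    (p q : X → ℝ≥0) (hp : Measurable p)
    (hP : P = μ.withDensity (fun x => (p x : ℝ≥0∞)))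
    (hQ : Q = μ.withDensity (fun x => (q x : ℝ≥0∞))) :
    P + Q = μ.withDensity (fun x => ((p x + q x : ℝ≥0) : ℝ≥0∞)) := by
  rw [hP, hQ, ← withDensity_add_left hp.coe_nnreal_ennreal]
  congr 1

lemma hellinger_eq {X : Type*} [MeasurableSpace X] (μ : Measure X) [SigmaFinite μ]
    (P Q : Measure X) [IsFiniteMeasure P] [IsFiniteMeasure Q]
    (p q : X → ℝ≥0) (hp : Measurable p) (hq : Measurable q)
    (hP : P = μ.withDensity (fun x => (p x : ℝ≥0∞)))
    (hQ : Q = μ.withDensity (fun x => (q x : ℝ≥0∞))) (a : ℝ) (ha : 0 < a) :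
    hellingerInt a P Q = ∫⁻ x, (p x : ℝ≥0∞) ^ a * (q x : ℝ≥0∞) ^ (1 - a) ∂μ := by
  have hadd := add_dens μ P Q p q hp hP hQ
  have e1 := dens_eq μ P (P + Q) p (fun x => p x + q x) hp (hp.add hq) hP hadd
    (Measure.absolutelyContinuous_of_le (Measure.le_add_right le_rfl))
  have e2 := dens_eq μ Q (P + Q) q (fun x => p x + q x) hq (hp.add hq) hQ hadd
    (Measure.absolutelyContinuous_of_le (Measure.le_add_left le_rfl))
  unfold hellingerInt
  have mm : Measurable (fun x => P.rnDeriv (P + Q) x ^ a * Q.rnDeriv (P + Q) x ^ (1 - a)) :=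
    ((Measure.measurable_rnDeriv P (P+Q)).pow_const _).mul
      ((Measure.measurable_rnDeriv Q (P+Q)).pow_const _)
  calc _ = ∫⁻ x, P.rnDeriv (P + Q) x ^ a * Q.rnDeriv (P + Q) x ^ (1 - a)
        ∂(μ.withDensity (fun x => ((p x + q x : ℝ≥0) : ℝ≥0∞))) := by rw [← hadd]
    _ = _ := by
      have mw : Measurable (fun x => ((p x + q x : ℝ≥0) : ℝ≥0∞)) := (hp.add hq).coe_nnreal_ennreal
      rw [lintegral_withDensity_eq_lintegral_mul _ mw mm]
      apply lintegral_congr_ae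
      filter_upwards [e1, e2] with x h1 h2
      simp only [Pi.mul_apply]
      by_cases hw : p x + q x = 0
      · have : p x = 0 := by simpa using (add_eq_zero.1 hw).1
        rw [hw, this]; simp [ha]
      · have hw' : ((p x + q x : ℝ≥0) : ℝ≥0∞) ≠ 0 := by exact_mod_cast hw
        generalize P.rnDeriv (P + Q) x = P' at *
        generalize Q.rnDeriv (P + Q) x = Q' at *
        generalize p x + q x = w at *
        rw [h1, h2, ENNReal.mul_rpow_eq_ite, ENNReal.mul_rpow_eq_ite]
        simp only [hw', false_and, ENNReal.coe_ne_top, or_self, if_false]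
        have : (w : ℝ≥0∞) = (w : ℝ≥0∞) ^ a * (w : ℝ≥0∞) ^ (1 - a) := by
          rw [← ENNReal.rpow_add _ _ hw' ENNReal.coe_ne_top]; simp
        nth_rw 1 [this]; ring

/-- real mixture density -/
noncomputable def mixd (α : ℝ) (l₁ l₂ a b : ℝ≥0) : ℝ≥0 := (l₁ * a ^ α + l₂ * b ^ α) ^ (1 / α)

lemma mixd_meas {X : Type*} [MeasurableSpace X] (α : ℝ) (l₁ l₂ : ℝ≥0) (p q : X → ℝ≥0)
    (hp : Measurable p) (hq : Measurable q) : Measurable (fun x => mixd α l₁ l₂ (p x) (q x)) := by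
  unfold mixd
  exact (((hp.pow_const _).const_mul _).add ((hq.pow_const _).const_mul _)).pow_const _

lemma alphaMix_eq {X : Type*} [MeasurableSpace X] (μ : Measure X) [SigmaFinite μ]
    (P Q : Measure X) [IsFiniteMeasure P] [IsFiniteMeasure Q]
    (p q : X → ℝ≥0) (hp : Measurable p) (hq : Measurable q)
    (hP : P = μ.withDensity (fun x => (p x : ℝ≥0∞)))
    (hQ : Q = μ.withDensity (fun x => (q x : ℝ≥0∞))) (a : ℝ) (ha : 0 < a) (l₁ l₂ : ℝ≥0) :
    alphaMix a l₁ l₂ P Q = (∫⁻ x, (mixd a l₁ l₂ (p x) (q x) : ℝ≥0∞) ∂μ)⁻¹ •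
      μ.withDensity (fun x => (mixd a l₁ l₂ (p x) (q x) : ℝ≥0∞)) := by
  have hadd := add_dens μ P Q p q hp hP hQ
  have e1 := dens_eq μ P (P + Q) p (fun x => p x + q x) hp (hp.add hq) hP hadd
    (Measure.absolutelyContinuous_of_le (Measure.le_add_right le_rfl))
  have e2 := dens_eq μ Q (P + Q) q (fun x => p x + q x) hq (hp.add hq) hQ hadd
    (Measure.absolutelyContinuous_of_le (Measure.le_add_left le_rfl))
  set F : X → ℝ≥0∞ := fun x =>
    ((l₁ : ℝ≥0∞) * P.rnDeriv (P + Q) x ^ a + l₂ * Q.rnDeriv (P + Q) x ^ a) ^ (1/a) with hF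
  have mm : Measurable F :=
    ((((Measure.measurable_rnDeriv P (P+Q)).pow_const _).const_mul _).add
      (((Measure.measurable_rnDeriv Q (P+Q)).pow_const _).const_mul _)).pow_const _
  have mw : Measurable (fun x => ((p x + q x : ℝ≥0) : ℝ≥0∞)) := (hp.add hq).coe_nnreal_ennreal
  have key : (fun x => ((p x + q x : ℝ≥0) : ℝ≥0∞)) * F =ᵐ[μ]
      (fun x => (mixd a l₁ l₂ (p x) (q x) : ℝ≥0∞)) := by
    filter_upwards [e1, e2] with x h1 h2
    simp only [Pi.mul_apply, hF]
    unfold mixd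
    generalize p x + q x = w at *
    rw [ENNReal.coe_rpow_of_nonneg _ (by positivity : 0 ≤ 1 / a), ENNReal.coe_add,
      ENNReal.coe_mul, ENNReal.coe_mul,
      ENNReal.coe_rpow_of_nonneg _ ha.le, ENNReal.coe_rpow_of_nonneg _ ha.le, h1, h2]
    rw [ENNReal.mul_rpow_of_nonneg _ _ ha.le, ENNReal.mul_rpow_of_nonneg _ _ ha.le]
    have : (l₁ : ℝ≥0∞) * ((w : ℝ≥0∞) ^ a * P.rnDeriv (P + Q) x ^ a) + l₂ * (w ^ a * Q.rnDeriv (P + Q) x ^ a)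
      = w ^ a * (l₁ * P.rnDeriv (P + Q) x ^ a + l₂ * Q.rnDeriv (P + Q) x ^ a) := by ring
    rw [this, ENNReal.mul_rpow_of_nonneg _ _ (by positivity), ← ENNReal.rpow_mul]
    rw [mul_one_div_cancel ha.ne', ENNReal.rpow_one]
  have hm : (P + Q).withDensity F = μ.withDensity (fun x => (mixd a l₁ l₂ (p x) (q x) : ℝ≥0∞)) := by
    conv_lhs => rw [hadd]
    rw [← withDensity_mul _ mw mm]
    exact withDensity_congr_ae key
  have hi : ∫⁻ x, F x ∂(P + Q) = ∫⁻ x, (mixd a l₁ l₂ (p x) (q x) : ℝ≥0∞) ∂μ := by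
    have : ∀ ν : Measure X, ∫⁻ x, F x ∂ν = ν.withDensity F Set.univ := by
      intro ν; simp [withDensity_apply]
    rw [this, hm]; simp
  have : alphaMix a l₁ l₂ P Q = (∫⁻ x, F x ∂(P + Q))⁻¹ • (P + Q).withDensity F := rfl
  rw [this, hi, hm]

lemma mix_dens {X : Type*} [MeasurableSpace X] (μ : Measure X) [SigmaFinite μ]
    (P Q : Measure X) [IsFiniteMeasure P] [IsFiniteMeasure Q]
    (p q : X → ℝ≥0) (hp : Measurable p) (hq : Measurable q)
    (hP : P = μ.withDensity (fun x => (p x : ℝ≥0∞)))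
    (hQ : Q = μ.withDensity (fun x => (q x : ℝ≥0∞))) (a : ℝ) (ha : 0 < a) (l₁ l₂ : ℝ≥0)
    (hprob : IsProbabilityMeasure (alphaMix a l₁ l₂ P Q)) :
    ∃ z : ℝ≥0, z ≠ 0 ∧ ∫⁻ x, (mixd a l₁ l₂ (p x) (q x) : ℝ≥0∞) ∂μ = z ∧
      alphaMix a l₁ l₂ P Q =
        μ.withDensity (fun x => ((z⁻¹ * mixd a l₁ l₂ (p x) (q x) : ℝ≥0) : ℝ≥0∞)) := by
  have h := alphaMix_eq μ P Q p q hp hq hP hQ a ha l₁ l₂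
  have h1 : alphaMix a l₁ l₂ P Q Set.univ = 1 := hprob.measure_univ
  rw [h] at h1
  simp only [Measure.smul_apply, smul_eq_mul, MeasurableSet.univ, withDensity_apply,
    Measure.restrict_univ] at h1
  have hz0 : ∫⁻ x, (mixd a l₁ l₂ (p x) (q x) : ℝ≥0∞) ∂μ ≠ 0 := by
    intro h0; rw [h0] at h1; simp at h1
  have hz1 : ∫⁻ x, (mixd a l₁ l₂ (p x) (q x) : ℝ≥0∞) ∂μ ≠ ⊤ := by
    intro h0; rw [h0] at h1; simp at h1
  refine ⟨(∫⁻ x, (mixd a l₁ l₂ (p x) (q x) : ℝ≥0∞) ∂μ).toNNReal, ?_, ?_, ?_⟩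
  · simp [ENNReal.toNNReal_eq_zero_iff, hz0, hz1]
  · rw [ENNReal.coe_toNNReal hz1]
  · rw [h, ← withDensity_smul _ (mixd_meas a l₁ l₂ p q hp hq).coe_nnreal_ennreal]
    congr 1; ext x
    simp only [Pi.smul_apply, smul_eq_mul, ENNReal.coe_mul]
    rw [ENNReal.coe_inv (by simp [ENNReal.toNNReal_eq_zero_iff, hz0, hz1]), ENNReal.coe_toNNReal hz1]

lemma lint_one {X : Type*} [MeasurableSpace X] (μ P : Measure X) [IsProbabilityMeasure P]
    (p : X → ℝ≥0) (hP : P = μ.withDensity (fun x => (p x : ℝ≥0∞))) :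
    ∫⁻ x, (p x : ℝ≥0∞) ∂μ = 1 := by
  have : P Set.univ = 1 := measure_univ
  rw [hP] at this; simpa using this

lemma mixd_coe (α : ℝ) (t : ℝ) (h0 : 0 ≤ t) (h1 : t ≤ 1) (s p : ℝ≥0) :
    ((mixd α (1 - t).toNNReal t.toNNReal s p : ℝ≥0) : ℝ) =
      ((1 - t) * (s : ℝ) ^ α + t * (p : ℝ) ^ α) ^ (1 / α) := by
  unfold mixd
  push_cast
  rw [Real.coe_toNNReal _ (by linarith), Real.coe_toNNReal _ h0]

lemma rpow_one_div_cancel' {α s : ℝ} (hα : 0 < α) (hs : 0 ≤ s) : (s ^ α) ^ (1 / α) = s := by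
  rw [← Real.rpow_mul hs, mul_one_div_cancel hα.ne', Real.rpow_one]

lemma pt_deriv {α s p : ℝ} (hα : 0 < α) (hs : 0 < s) :
    Tendsto (fun t : ℝ => (((1 - t) * s ^ α + t * p ^ α) ^ (1 / α) - s) / t) (𝓝[>] 0)
      (𝓝 ((1 / α) * (p ^ α * s ^ (1 - α)) - s / α)) := by
  have hsα : 0 < s ^ α := Real.rpow_pos_of_pos hs α
  have h1 : HasDerivAt (fun t : ℝ => (1 - t) * s ^ α + t * p ^ α) (-1 * s ^ α + 1 * p ^ α) 0 := by
    apply HasDerivAt.add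
    · exact ((hasDerivAt_id (0:ℝ)).const_sub 1).mul_const _
    · exact (hasDerivAt_id (0:ℝ)).mul_const _
  have h2 := h1.rpow_const (p := 1 / α) (Or.inl (by simpa using hsα.ne'))
  have h3 := h2.tendsto_slope_zero_right
  simp only [zero_add, sub_zero, one_mul, zero_mul, add_zero, smul_eq_mul] at h3
  rw [rpow_one_div_cancel' hα hs.le] at h3
  have e : (-1 * s ^ α + p ^ α) * (1 / α) * (s ^ α) ^ (1 / α - 1)
      = (1 / α) * (p ^ α * s ^ (1 - α)) - s / α := by
    have e1 : (s ^ α) ^ (1 / α - 1) = s ^ (1 - α) := by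
      rw [← Real.rpow_mul hs.le]; congr 1; field_simp
    have e2 : s ^ α * s ^ (1 - α) = s := by
      rw [← Real.rpow_add hs]; simp
    rw [e1]
    have : (-1 * s ^ α + p ^ α) * (1 / α) * s ^ (1 - α) =
      (1 / α) * (p ^ α * s ^ (1 - α)) - (s ^ α * s ^ (1 - α)) / α := by ring
    rw [this, e2]
  rw [e] at h3
  refine h3.congr (fun t => ?_)
  ring

lemma pt_gt {α : ℝ} (hα : 1 < α) (s p : ℝ≥0) :
    Tendsto (fun t : ℝ => ENNReal.ofReal
        ((((1 - t) * (s : ℝ) ^ α + t * (p : ℝ) ^ α) ^ (1 / α) - (1 - t) * s) / t)) (𝓝[>] 0)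
      (𝓝 (ENNReal.ofReal (1 / α) * ((p : ℝ≥0∞) ^ α * (s : ℝ≥0∞) ^ (1 - α))
        + ENNReal.ofReal (1 - 1 / α) * s)) := by
  have hα0 : 0 < α := by linarith
  have hinv : 1 / α < 1 := by rw [div_lt_one hα0]; exact hα
  by_cases hs : s = 0
  · subst hs
    by_cases hp : p = 0
    · subst hp
      simp [hα0, hα0.ne', Real.zero_rpow]
    · have hp' : (0:ℝ) < p := by positivity
      have e : ENNReal.ofReal (1 / α) * ((p : ℝ≥0∞) ^ α * ((0 : ℝ≥0) : ℝ≥0∞) ^ (1 - α))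
        + ENNReal.ofReal (1 - 1 / α) * ((0 : ℝ≥0) : ℝ≥0∞) = ⊤ := by
        rw [ENNReal.coe_zero, ENNReal.zero_rpow_of_neg (by linarith), ENNReal.mul_top,
          ENNReal.mul_top]
        · simp
        · simp [hα0]
        · simp [hα0, hp]
      rw [e]
      apply ENNReal.tendsto_ofReal_atTop.comp
      have : Tendsto (fun t : ℝ => t ^ (1 / α - 1) * p) (𝓝[>] 0) atTop :=
        (tendsto_rpow_neg_nhdsGT_zero (by linarith)).atTop_mul_const hp'
      refine this.congr' ?_
      filter_upwards [self_mem_nhdsWithin] with t ht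
      have ht : 0 < t := ht
      simp only [NNReal.coe_zero, Real.zero_rpow hα0.ne', mul_zero, zero_add, sub_zero]
      rw [Real.mul_rpow ht.le (by positivity), rpow_one_div_cancel' hα0 hp'.le,
        Real.rpow_sub_one ht.ne']
      ring
  · have hs' : (0:ℝ) < s := by positivity
    have h := (pt_deriv (p := p) hα0 hs').add_const (s : ℝ)
    have h2 := ENNReal.tendsto_ofReal h
    have e : ENNReal.ofReal ((1 / α) * ((p:ℝ) ^ α * (s:ℝ) ^ (1 - α)) - s / α + s) =
      ENNReal.ofReal (1 / α) * ((p : ℝ≥0∞) ^ α * (s : ℝ≥0∞) ^ (1 - α))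
        + ENNReal.ofReal (1 - 1 / α) * s := by
      have : (1 / α) * ((p:ℝ) ^ α * (s:ℝ) ^ (1 - α)) - s / α + s =
        (1 / α) * ((p:ℝ) ^ α * (s:ℝ) ^ (1 - α)) + (1 - 1 / α) * s := by ring
      rw [this, ENNReal.ofReal_add (by positivity) (mul_nonneg (by linarith) hs'.le),
        ENNReal.ofReal_mul (by positivity), ENNReal.ofReal_mul (by positivity),
        ENNReal.ofReal_mul (by linarith), ENNReal.ofReal_coe_nnreal,
        ← ENNReal.ofReal_rpow_of_pos hs', ← ENNReal.ofReal_rpow_of_nonneg (by positivity) hα0.le]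
      simp
    rw [← e]
    refine h2.congr' ?_
    filter_upwards [self_mem_nhdsWithin] with t ht
    have ht : 0 < t := ht
    congr 1
    field_simp
    ring

lemma pt_lt {α : ℝ} (hα0 : 0 < α) (hα : α < 1) (s p : ℝ≥0) :
    Tendsto (fun t : ℝ =>
        ((1 - t) * s + t * p - ((1 - t) * (s : ℝ) ^ α + t * (p : ℝ) ^ α) ^ (1 / α)) / t) (𝓝[>] 0)
      (𝓝 (p + (1 / α - 1) * s - (1 / α) * ((p : ℝ) ^ α * (s : ℝ) ^ (1 - α)))) := by
  have hinv : 1 < 1 / α := by rw [lt_div_iff₀ hα0]; linarith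
  by_cases hs : s = 0
  · subst hs
    have h1 : Tendsto (fun t : ℝ => (p:ℝ) - t ^ (1 / α - 1) * p) (𝓝[>] 0) (𝓝 ((p:ℝ) - 0 ^ (1 / α - 1) * p)) := by
      apply Tendsto.mono_left _ nhdsWithin_le_nhds
      apply Tendsto.const_sub
      apply Tendsto.mul_const
      exact (Real.continuousAt_rpow_const _ _ (Or.inr (by linarith))).tendsto
    have e : (p:ℝ) - 0 ^ (1 / α - 1) * p = (p + (1 / α - 1) * ((0:ℝ≥0):ℝ) - (1 / α) * ((p : ℝ) ^ α * ((0:ℝ≥0) : ℝ) ^ (1 - α))) := by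
      rw [NNReal.coe_zero, Real.zero_rpow (by linarith), Real.zero_rpow (by linarith)]; ring
    rw [← e]
    refine h1.congr' ?_
    filter_upwards [self_mem_nhdsWithin] with t ht
    have ht : 0 < t := ht
    simp only [NNReal.coe_zero, Real.zero_rpow hα0.ne', mul_zero, zero_add]
    rw [Real.mul_rpow ht.le (by positivity), rpow_one_div_cancel' hα0 p.coe_nonneg,
        Real.rpow_sub_one ht.ne']
    field_simp
  · have hs' : (0:ℝ) < s := by positivity
    have h := (pt_deriv (p := p) hα0 hs').const_sub ((p : ℝ) - s)
    have e : (p : ℝ) - s - ((1 / α) * ((p:ℝ) ^ α * (s:ℝ) ^ (1 - α)) - s / α) =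
      p + (1 / α - 1) * s - (1 / α) * ((p : ℝ) ^ α * (s : ℝ) ^ (1 - α)) := by ring
    rw [← e]
    refine h.congr' ?_
    filter_upwards [self_mem_nhdsWithin] with t ht
    have ht : 0 < t := ht
    field_simp
    ring

lemma mix_ge {α : ℝ} (hα : 1 < α) {t s p : ℝ} (ht : 0 ≤ t) (ht1 : t ≤ 1) (hs : 0 ≤ s) (hp : 0 ≤ p) :
    (1 - t) * s ≤ ((1 - t) * s ^ α + t * p ^ α) ^ (1 / α) := by
  have hα0 : 0 < α := by linarith
  have hinv : 1 / α ≤ 1 := by rw [div_le_one hα0]; exact hα.le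
  have h := (Real.concaveOn_rpow (p := 1 / α) (by positivity) hinv).2
    (show s ^ α ∈ Set.Ici 0 by simp; positivity) (show p ^ α ∈ Set.Ici 0 by simp; positivity)
    (show 0 ≤ 1 - t by linarith) ht (by ring)
  simp only [smul_eq_mul, rpow_one_div_cancel' hα0 hs, rpow_one_div_cancel' hα0 hp] at h
  have := mul_nonneg ht hp
  linarith

lemma mix_le {α : ℝ} (hα0 : 0 < α) (hα : α < 1) {t s p : ℝ} (ht : 0 ≤ t) (ht1 : t ≤ 1)
    (hs : 0 ≤ s) (hp : 0 ≤ p) :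
    ((1 - t) * s ^ α + t * p ^ α) ^ (1 / α) ≤ (1 - t) * s + t * p := by
  have hinv : 1 ≤ 1 / α := by rw [le_div_iff₀ hα0]; linarith
  have h := (convexOn_rpow (p := 1 / α) hinv).2
    (show s ^ α ∈ Set.Ici 0 by simp; positivity) (show p ^ α ∈ Set.Ici 0 by simp; positivity)
    (show 0 ≤ 1 - t by linarith) ht (by ring)
  simpa only [smul_eq_mul, rpow_one_div_cancel' hα0 hs, rpow_one_div_cancel' hα0 hp] using h

lemma nhdsGT_unit : ∀ᶠ t in 𝓝[>] (0:ℝ), 0 < t ∧ t < 1 := by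
  filter_upwards [Ioo_mem_nhdsGT (zero_lt_one : (0:ℝ) < 1)] with t ht using ht

lemma core_gt {X : Type*} [MeasurableSpace X] (μ : Measure X) {α : ℝ} (hα : 1 < α)
    (s p : X → ℝ≥0) (hs : Measurable s) (hp : Measurable p)
    (is : ∫⁻ x, (s x : ℝ≥0∞) ∂μ = 1) (C : ℝ) (hC : 1 ≤ C)
    (hZ : ∀ t : ℝ, 0 < t → t < 1 →
      ∫⁻ x, (mixd α (1 - t).toNNReal t.toNNReal (s x) (p x) : ℝ≥0∞) ∂μ
        ≤ ENNReal.ofReal (1 + t * (C - 1) / α)) :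
    ∫⁻ x, (p x : ℝ≥0∞) ^ α * (s x : ℝ≥0∞) ^ (1 - α) ∂μ ≤ ENNReal.ofReal C := by
  have hα0 : 0 < α := by linarith
  have hinv : 1 / α < 1 := by rw [div_lt_one hα0]; exact hα
  set G : ℝ → X → ℝ≥0∞ := fun t x => ENNReal.ofReal
        ((((1 - t) * (s x : ℝ) ^ α + t * (p x : ℝ) ^ α) ^ (1 / α) - (1 - t) * s x) / t) with hG
  have mG : ∀ t, Measurable (G t) := by
    intro t; simp only [hG]; fun_prop
  have bound : ∀ᶠ t in 𝓝[>] (0:ℝ), ∫⁻ x, G t x ∂μ ≤ ENNReal.ofReal (1 + (C - 1) / α) := by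
    filter_upwards [nhdsGT_unit] with t ⟨t0, t1⟩
    have e : ∀ x, (mixd α (1 - t).toNNReal t.toNNReal (s x) (p x) : ℝ≥0∞)
        = ENNReal.ofReal t * G t x + ENNReal.ofReal (1 - t) * s x := by
      intro x
      have hge := mix_ge hα t0.le t1.le (s x).coe_nonneg (p x).coe_nonneg
      rw [← ENNReal.ofReal_coe_nnreal, mixd_coe α t t0.le t1.le, ← ENNReal.ofReal_coe_nnreal,
        ← ENNReal.ofReal_mul t0.le, ← ENNReal.ofReal_mul (by linarith), ← ENNReal.ofReal_add]
      · congr 1; field_simp; ring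
      · have : 0 ≤ (((1 - t) * (s x : ℝ) ^ α + t * (p x : ℝ) ^ α) ^ (1 / α) - (1 - t) * s x) := by
          linarith
        positivity
      · exact mul_nonneg (by linarith) (s x).coe_nonneg
    have h := hZ t t0 t1
    simp_rw [e] at h
    rw [lintegral_add_left ((mG t).const_mul _), lintegral_const_mul _ (mG t),
      lintegral_const_mul _ hs.coe_nnreal_ennreal, is, mul_one] at h
    have h3 : ENNReal.ofReal (1 + t * (C - 1) / α) =
        ENNReal.ofReal t * ENNReal.ofReal (1 + (C - 1) / α) + ENNReal.ofReal (1 - t) := by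
      have : 0 ≤ (C - 1) / α := div_nonneg (by linarith) hα0.le
      rw [← ENNReal.ofReal_mul t0.le, ← ENNReal.ofReal_add (by positivity) (by linarith)]
      congr 1; ring
    rw [h3] at h
    have h4 := (ENNReal.add_le_add_iff_right ENNReal.ofReal_ne_top).1 h
    exact (ENNReal.mul_le_mul_iff_right (by simpa using t0) ENNReal.ofReal_ne_top).1 h4
  have fatou := lintegral_liminf_le (μ := μ) (u := 𝓝[>] (0:ℝ)) mG
  have hl : ∀ x, liminf (fun t => G t x) (𝓝[>] (0:ℝ)) =
      ENNReal.ofReal (1 / α) * ((p x : ℝ≥0∞) ^ α * (s x : ℝ≥0∞) ^ (1 - α))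
        + ENNReal.ofReal (1 - 1 / α) * s x := fun x => (pt_gt hα (s x) (p x)).liminf_eq
  simp_rw [hl] at fatou
  rw [lintegral_add_right _ (hs.coe_nnreal_ennreal.const_mul _),
    lintegral_const_mul _ (by fun_prop), lintegral_const_mul _ hs.coe_nnreal_ennreal, is, mul_one]
    at fatou
  have h5 := fatou.trans (liminf_le_of_frequently_le' bound.frequently)
  have h6 : ENNReal.ofReal (1 + (C - 1) / α) =
      ENNReal.ofReal (1 / α) * ENNReal.ofReal C + ENNReal.ofReal (1 - 1 / α) := by
    rw [← ENNReal.ofReal_mul (by positivity), ← ENNReal.ofReal_add (by positivity) (by linarith)]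
    congr 1; ring
  rw [h6] at h5
  have h7 := (ENNReal.add_le_add_iff_right ENNReal.ofReal_ne_top).1 h5
  exact (ENNReal.mul_le_mul_iff_right (by simpa using hα0) ENNReal.ofReal_ne_top).1 h7

lemma core_lt {X : Type*} [MeasurableSpace X] (μ : Measure X) {α : ℝ} (hα0 : 0 < α) (hα : α < 1)
    (s p : X → ℝ≥0) (hs : Measurable s) (hp : Measurable p)
    (is : ∫⁻ x, (s x : ℝ≥0∞) ∂μ = 1) (ip : ∫⁻ x, (p x : ℝ≥0∞) ∂μ = 1)
    (C : ℝ) (hC0 : 0 ≤ C) (hC : C ≤ 1)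
    (hZ : ∀ t : ℝ, 0 < t → t < 1 → ENNReal.ofReal (1 + t * (C - 1) / α) ≤
      ∫⁻ x, (mixd α (1 - t).toNNReal t.toNNReal (s x) (p x) : ℝ≥0∞) ∂μ) :
    ENNReal.ofReal C ≤ ∫⁻ x, (p x : ℝ≥0∞) ^ α * (s x : ℝ≥0∞) ^ (1 - α) ∂μ := by
  have hinv : 1 < 1 / α := by rw [lt_div_iff₀ hα0]; linarith
  set G : ℝ → X → ℝ≥0∞ := fun t x => ENNReal.ofReal
        (((1 - t) * s x + t * p x - ((1 - t) * (s x : ℝ) ^ α + t * (p x : ℝ) ^ α) ^ (1 / α)) / t)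
    with hG
  have mG : ∀ t, Measurable (G t) := by
    intro t; simp only [hG]; fun_prop
  have bound : ∀ᶠ t in 𝓝[>] (0:ℝ), ∫⁻ x, G t x ∂μ ≤ ENNReal.ofReal ((1 - C) / α) := by
    filter_upwards [nhdsGT_unit, Ioo_mem_nhdsGT hα0] with t ⟨t0, t1⟩ ⟨_, tα⟩
    have e : ∀ x, ENNReal.ofReal t * G t x + (mixd α (1 - t).toNNReal t.toNNReal (s x) (p x) : ℝ≥0∞)
        = ENNReal.ofReal (1 - t) * s x + ENNReal.ofReal t * p x := by
      intro x
      have hge := mix_le hα0 hα t0.le t1.le (s x).coe_nonneg (p x).coe_nonneg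
      rw [← ENNReal.ofReal_coe_nnreal, mixd_coe α t t0.le t1.le, ← ENNReal.ofReal_coe_nnreal,
        ← ENNReal.ofReal_coe_nnreal,
        ← ENNReal.ofReal_mul t0.le, ← ENNReal.ofReal_mul t0.le, ← ENNReal.ofReal_mul (by linarith),
        ← ENNReal.ofReal_add, ← ENNReal.ofReal_add]
      · congr 1; field_simp; ring
      · exact mul_nonneg (by linarith) (s x).coe_nonneg
      · positivity
      · have : 0 ≤ ((1 - t) * s x + t * p x - ((1 - t) * (s x : ℝ) ^ α + t * (p x : ℝ) ^ α) ^ (1 / α)) := by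
          linarith
        positivity
      · have : 0 ≤ 1 - t := by linarith
        positivity
    have e2 := lintegral_congr (μ := μ) e
    rw [lintegral_add_left ((mG t).const_mul _), lintegral_const_mul _ (mG t),
      lintegral_add_left (hs.coe_nnreal_ennreal.const_mul _),
      lintegral_const_mul _ hs.coe_nnreal_ennreal, lintegral_const_mul _ hp.coe_nnreal_ennreal,
      is, ip, mul_one, mul_one, ← ENNReal.ofReal_add (by linarith) t0.le] at e2
    have h := add_le_add_right (hZ t t0 t1) (ENNReal.ofReal t * ∫⁻ x, G t x ∂μ)
    rw [e2] at h
    have hz : 0 ≤ 1 + t * (C - 1) / α := by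
      have h1 : t * (1 - C) / α ≤ 1 := by
        rw [div_le_one hα0]; nlinarith
      have h2 : t * (C - 1) / α = - (t * (1 - C) / α) := by ring
      linarith
    have hh : ENNReal.ofReal (1 - t + t) = ENNReal.ofReal t * ENNReal.ofReal ((1 - C) / α) +
        ENNReal.ofReal (1 + t * (C - 1) / α) := by
      have : 0 ≤ (1 - C) / α := div_nonneg (by linarith) hα0.le
      rw [← ENNReal.ofReal_mul t0.le, ← ENNReal.ofReal_add (by positivity) hz]
      congr 1; ring
    rw [hh] at h
    have h4 := (ENNReal.add_le_add_iff_right ENNReal.ofReal_ne_top).1 h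
    exact (ENNReal.mul_le_mul_iff_right (by simpa using t0) ENNReal.ofReal_ne_top).1 h4
  have fatou := lintegral_liminf_le (μ := μ) (u := 𝓝[>] (0:ℝ)) mG
  have hl : ∀ x, liminf (fun t => G t x) (𝓝[>] (0:ℝ)) = ENNReal.ofReal
      (p x + (1 / α - 1) * s x - (1 / α) * ((p x : ℝ) ^ α * (s x : ℝ) ^ (1 - α))) :=
    fun x => (ENNReal.tendsto_ofReal (pt_lt hα0 hα (s x) (p x))).liminf_eq
  simp_rw [hl] at fatou
  have h5 := fatou.trans (liminf_le_of_frequently_le' bound.frequently)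
  have hsum : ∀ x, (p x : ℝ≥0∞) + ENNReal.ofReal (1 / α - 1) * s x =
      ENNReal.ofReal (p x + (1 / α - 1) * s x - (1 / α) * ((p x : ℝ) ^ α * (s x : ℝ) ^ (1 - α)))
      + ENNReal.ofReal (1 / α) * ((p x : ℝ≥0∞) ^ α * (s x : ℝ≥0∞) ^ (1 - α)) := by
    intro x
    have hnn : 0 ≤ p x + (1 / α - 1) * s x - (1 / α) * ((p x : ℝ) ^ α * (s x : ℝ) ^ (1 - α)) := by
      refine ge_of_tendsto (pt_lt hα0 hα (s x) (p x)) ?_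
      filter_upwards [nhdsGT_unit] with t ⟨t0, t1⟩
      have hge := mix_le hα0 hα t0.le t1.le (s x).coe_nonneg (p x).coe_nonneg
      exact div_nonneg (by linarith) t0.le
    rw [← ENNReal.ofReal_coe_nnreal, ← ENNReal.ofReal_coe_nnreal,
      ENNReal.ofReal_rpow_of_nonneg (by positivity) hα0.le,
      ENNReal.ofReal_rpow_of_nonneg (by positivity) (by linarith),
      ← ENNReal.ofReal_mul (by positivity), ← ENNReal.ofReal_mul (by positivity),
      ← ENNReal.ofReal_mul (by linarith), ← ENNReal.ofReal_add hnn (by positivity),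
      ← ENNReal.ofReal_add (by positivity) (mul_nonneg (by linarith) (by positivity))]
    congr 1; ring
  have h6 := lintegral_congr (μ := μ) hsum
  rw [lintegral_add_left hp.coe_nnreal_ennreal, lintegral_const_mul _ hs.coe_nnreal_ennreal,
    is, ip, lintegral_add_left (by fun_prop), lintegral_const_mul _ (by fun_prop), mul_one] at h6
  have h7 : ENNReal.ofReal ((1 - C) / α) + ENNReal.ofReal (1 / α) * ENNReal.ofReal C ≤
      ENNReal.ofReal ((1 - C) / α) + ENNReal.ofReal (1 / α) *
      ∫⁻ x, (p x : ℝ≥0∞) ^ α * (s x : ℝ≥0∞) ^ (1 - α) ∂μ := by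
    refine le_trans (le_of_eq ?_) (add_le_add_left h5 _)
    rw [← h6, ← ENNReal.ofReal_one, ← ENNReal.ofReal_add zero_le_one (by linarith),
      ← ENNReal.ofReal_mul (by positivity),
      ← ENNReal.ofReal_add (div_nonneg (by linarith) hα0.le) (by positivity)]
    congr 1; ring
  have h8 := (ENNReal.add_le_add_iff_left ENNReal.ofReal_ne_top).1 h7
  exact (ENNReal.mul_le_mul_iff_right (by simpa using hα0) ENNReal.ofReal_ne_top).1 h8

lemma ereal_pos_mul_iff {c : ℝ} (hc : 0 < c) (x y : EReal) :
    (c : EReal) * x ≤ (c : EReal) * y ↔ x ≤ y := by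
  constructor
  · intro h
    have h2 := mul_le_mul_of_nonneg_left h (show (0:EReal) ≤ ((c⁻¹ : ℝ) : EReal) by
      exact_mod_cast (inv_pos.2 hc).le)
    rwa [← mul_assoc, ← mul_assoc, ← EReal.coe_mul, inv_mul_cancel₀ hc.ne', EReal.coe_one, one_mul,
      one_mul] at h2
  · intro h
    exact mul_le_mul_of_nonneg_left h (by exact_mod_cast hc.le)

lemma renyiSimple_le_gt {X : Type*} [MeasurableSpace X] {α : ℝ} (hα : 1 < α) (P Q P' Q' : Measure X) :
    renyiSimple α P Q ≤ renyiSimple α P' Q' ↔ hellingerInt α P Q ≤ hellingerInt α P' Q' := by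
  unfold renyiSimple
  rw [ereal_pos_mul_iff (inv_pos.2 (by linarith)), ENNReal.log_le_log_iff]

lemma renyiSimple_lt_eq {X : Type*} [MeasurableSpace X] {α : ℝ} (P Q : Measure X) :
    renyiSimple α P Q = -((((1 - α)⁻¹ : ℝ) : EReal) * ENNReal.log (hellingerInt α P Q)) := by
  unfold renyiSimple
  have : (α - 1)⁻¹ = -(1 - α)⁻¹ := by rw [← inv_neg]; ring_nf
  rw [this, EReal.coe_neg, EReal.neg_mul]

lemma renyiSimple_le_lt {X : Type*} [MeasurableSpace X] {α : ℝ} (hα : α < 1) (P Q P' Q' : Measure X) :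
    renyiSimple α P Q ≤ renyiSimple α P' Q' ↔ hellingerInt α P' Q' ≤ hellingerInt α P Q := by
  rw [renyiSimple_lt_eq, renyiSimple_lt_eq, EReal.neg_le_neg_iff,
    ereal_pos_mul_iff (inv_pos.2 (by linarith)), ENNReal.log_le_log_iff]

lemma mix_hellinger {X : Type*} [MeasurableSpace X] (μ : Measure X) [SigmaFinite μ]
    (P R Q : Measure X) [IsFiniteMeasure P] [IsFiniteMeasure R] [IsFiniteMeasure Q]
    (p s q : X → ℝ≥0) (hp : Measurable p) (hs : Measurable s) (hq : Measurable q)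
    (hP : P = μ.withDensity (fun x => (p x : ℝ≥0∞)))
    (hR : R = μ.withDensity (fun x => (s x : ℝ≥0∞)))
    (hQ : Q = μ.withDensity (fun x => (q x : ℝ≥0∞))) (a : ℝ) (ha : 0 < a) (l₁ l₂ : ℝ≥0)
    (hprob : IsProbabilityMeasure (alphaMix a l₁ l₂ R P)) :
    ∃ z : ℝ≥0, z ≠ 0 ∧ ∫⁻ x, (mixd a l₁ l₂ (s x) (p x) : ℝ≥0∞) ∂μ = z ∧
      ((z ^ a : ℝ≥0) : ℝ≥0∞) * hellingerInt a (alphaMix a l₁ l₂ R P) Q =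
        l₁ * hellingerInt a R Q + l₂ * hellingerInt a P Q := by
  obtain ⟨z, z0, hz, hm⟩ := mix_dens μ R P s p hs hp hR hP a ha l₁ l₂ hprob
  refine ⟨z, z0, hz, ?_⟩
  have mf := mixd_meas a l₁ l₂ s p hs hp
  rw [hellinger_eq μ _ Q _ q (mf.const_mul z⁻¹) hq hm hQ a ha,
    hellinger_eq μ R Q s q hs hq hR hQ a ha, hellinger_eq μ P Q p q hp hq hP hQ a ha,
    ← lintegral_const_mul _ (by fun_prop), ← lintegral_const_mul _ (by fun_prop),
    ← lintegral_const_mul _ (by fun_prop), ← lintegral_add_left (by fun_prop)]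
  apply lintegral_congr
  intro x
  have : z ^ a * (z⁻¹ * mixd a l₁ l₂ (s x) (p x)) ^ a = l₁ * s x ^ a + l₂ * p x ^ a := by
    rw [← NNReal.mul_rpow, ← mul_assoc, mul_inv_cancel₀ z0, one_mul]
    unfold mixd
    rw [← NNReal.rpow_mul, one_div_mul_cancel ha.ne', NNReal.rpow_one]
  rw [← mul_assoc, ← mul_assoc, ← mul_assoc, ← add_mul]
  congr 1
  rw [← ENNReal.coe_rpow_of_nonneg _ ha.le, ← ENNReal.coe_rpow_of_nonneg _ ha.le,
    ← ENNReal.coe_rpow_of_nonneg _ ha.le]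
  exact_mod_cast this

lemma hellinger_le_one {X : Type*} [MeasurableSpace X] (μ : Measure X)
    (p q : X → ℝ≥0) (hp : Measurable p) (hq : Measurable q)
    (ip : ∫⁻ x, (p x : ℝ≥0∞) ∂μ = 1) (iq : ∫⁻ x, (q x : ℝ≥0∞) ∂μ = 1) (a : ℝ) (ha : 0 < a)
    (ha1 : a < 1) : ∫⁻ x, (p x : ℝ≥0∞) ^ a * (q x : ℝ≥0∞) ^ (1 - a) ∂μ ≤ 1 := by
  have := ENNReal.lintegral_mul_norm_pow_le (μ := μ) hp.coe_nnreal_ennreal.aemeasurable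
    hq.coe_nnreal_ennreal.aemeasurable ha.le (show 0 ≤ 1 - a by linarith) (by ring)
  simpa [ip, iq] using this

lemma simple_gt {X : Type*} [MeasurableSpace X] {α : ℝ} (hα : 1 < α)
    (P R Q : Measure X) [IsProbabilityMeasure P] [IsProbabilityMeasure R] [IsProbabilityMeasure Q]
    (hprob : ∀ l₁ l₂ : ℝ≥0, l₁ + l₂ = 1 → IsProbabilityMeasure (alphaMix α l₁ l₂ R P))
    (hmin0 : renyiSimple α R Q ≤ renyiSimple α P Q)
    (hmin : ∀ l₁ l₂ : ℝ≥0, l₁ + l₂ = 1 →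
      renyiSimple α R Q ≤ renyiSimple α (alphaMix α l₁ l₂ R P) Q) :
    renyiSimple α P R + renyiSimple α R Q ≤ renyiSimple α P Q := by
  have hα0 : 0 < α := by linarith
  have hinv : 1 / α < 1 := by rw [div_lt_one hα0]; exact hα
  set μ := P + R + Q with hμ
  obtain ⟨p, hp, hP⟩ := exists_dens P μ (Measure.absolutelyContinuous_of_le
    (by rw [hμ, add_assoc]; exact Measure.le_add_right le_rfl))
  obtain ⟨s, hs, hR⟩ := exists_dens R μ (Measure.absolutelyContinuous_of_le
    (by rw [hμ]; exact Measure.le_add_right (Measure.le_add_left le_rfl)))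
  obtain ⟨q, hq, hQ⟩ := exists_dens Q μ (Measure.absolutelyContinuous_of_le
    (by rw [hμ]; exact Measure.le_add_left le_rfl))
  rw [renyiSimple_le_gt hα] at hmin0
  suffices h : hellingerInt α P R * hellingerInt α R Q ≤ hellingerInt α P Q by
    unfold renyiSimple
    have hc : 0 < (α - 1)⁻¹ := inv_pos.2 (by linarith)
    rw [← EReal.left_distrib_of_nonneg_of_ne_top (by exact_mod_cast hc.le) (EReal.coe_ne_top _),
      ereal_pos_mul_iff hc, ← ENNReal.log_mul_add, ENNReal.log_le_log_iff]
    exact h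
  by_cases hA0 : hellingerInt α R Q = 0
  · simp [hA0]
  by_cases hB : hellingerInt α P Q = ⊤
  · simp [hB]
  have hA : hellingerInt α R Q ≠ ⊤ := ne_top_of_le_ne_top hB hmin0
  set a := (hellingerInt α R Q).toReal with ha
  set b := (hellingerInt α P Q).toReal with hb
  have ea : hellingerInt α R Q = ENNReal.ofReal a := (ENNReal.ofReal_toReal hA).symm
  have eb : hellingerInt α P Q = ENNReal.ofReal b := (ENNReal.ofReal_toReal hB).symm
  have apos : 0 < a := ENNReal.toReal_pos hA0 hA
  have hab : a ≤ b := ENNReal.toReal_mono hB hmin0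
  have hC : 1 ≤ b / a := by rw [le_div_iff₀ apos]; linarith
  have key : hellingerInt α P R ≤ ENNReal.ofReal (b / a) := by
    rw [hellinger_eq μ P R p s hp hs hP hR α hα0]
    apply core_gt μ hα s p hs hp (lint_one μ R s hR) _ hC
    intro t t0 t1
    have hl : (1 - t).toNNReal + t.toNNReal = 1 := by
      rw [← Real.toNNReal_add (by linarith) t0.le]; simp
    obtain ⟨z, z0, hz, hh⟩ := mix_hellinger μ P R Q p s q hp hs hq hP hR hQ α hα0
      (1 - t).toNNReal t.toNNReal (hprob _ _ hl)
    have hm := (renyiSimple_le_gt hα _ _ _ _).1 (hmin _ _ hl)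
    have h1 := mul_le_mul_right hm ((z ^ α : ℝ≥0) : ℝ≥0∞)
    rw [hh, ea, eb] at h1
    rw [hz, ← ENNReal.ofReal_coe_nnreal]
    apply ENNReal.ofReal_le_ofReal
    change _ ≤ ENNReal.ofReal (1 - t) * _ + ENNReal.ofReal t * _ at h1
    rw [← ENNReal.ofReal_coe_nnreal, ← ENNReal.ofReal_mul (by positivity),
      ← ENNReal.ofReal_mul (by linarith), ← ENNReal.ofReal_mul t0.le,
      ← ENNReal.ofReal_add (mul_nonneg (by linarith) apos.le) (mul_nonneg t0.le (by linarith))] at h1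
    have h2 := (ENNReal.ofReal_le_ofReal_iff (add_nonneg (mul_nonneg (by linarith) apos.le)
      (mul_nonneg t0.le (by linarith)))).1 h1
    have h3 : (z : ℝ) ^ α ≤ 1 + t * (b / a - 1) := by
      have : 1 + t * (b / a - 1) = ((1 - t) * a + t * b) / a := by field_simp; ring
      rw [this, le_div_iff₀ apos]
      simpa using h2
    have h4 : (z : ℝ) ≤ (1 + t * (b / a - 1)) ^ (1 / α) := by
      rw [← rpow_one_div_cancel' hα0 z.coe_nonneg]
      exact Real.rpow_le_rpow (by positivity) h3 (by positivity)
    have h5 := rpow_one_add_le_one_add_mul_self (s := t * (b / a - 1))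
      (by nlinarith [mul_nonneg t0.le (sub_nonneg.2 hC)]) (p := 1 / α) (by positivity) hinv.le
    refine (h4.trans h5).trans (le_of_eq ?_)
    ring
  calc _ ≤ ENNReal.ofReal (b / a) * ENNReal.ofReal a := by rw [← ea]; gcongr
    _ = _ := by
      rw [← ENNReal.ofReal_mul (by positivity), eb]; congr 1; field_simp

lemma simple_lt {X : Type*} [MeasurableSpace X] {α : ℝ} (hα0 : 0 < α) (hα : α < 1)
    (P R Q : Measure X) [IsProbabilityMeasure P] [IsProbabilityMeasure R] [IsProbabilityMeasure Q]
    (hprob : ∀ l₁ l₂ : ℝ≥0, l₁ + l₂ = 1 → IsProbabilityMeasure (alphaMix α l₁ l₂ R P))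
    (hmin0 : renyiSimple α R Q ≤ renyiSimple α P Q)
    (hmin : ∀ l₁ l₂ : ℝ≥0, l₁ + l₂ = 1 →
      renyiSimple α R Q ≤ renyiSimple α (alphaMix α l₁ l₂ R P) Q) :
    renyiSimple α P R + renyiSimple α R Q ≤ renyiSimple α P Q := by
  have hinv : 1 < 1 / α := by rw [lt_div_iff₀ hα0]; linarith
  set μ := P + R + Q with hμ
  obtain ⟨p, hp, hP⟩ := exists_dens P μ (Measure.absolutelyContinuous_of_le
    (by rw [hμ, add_assoc]; exact Measure.le_add_right le_rfl))
  obtain ⟨s, hs, hR⟩ := exists_dens R μ (Measure.absolutelyContinuous_of_le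
    (by rw [hμ]; exact Measure.le_add_right (Measure.le_add_left le_rfl)))
  obtain ⟨q, hq, hQ⟩ := exists_dens Q μ (Measure.absolutelyContinuous_of_le
    (by rw [hμ]; exact Measure.le_add_left le_rfl))
  rw [renyiSimple_le_lt hα] at hmin0
  have hA1 : hellingerInt α R Q ≤ 1 := by
    rw [hellinger_eq μ R Q s q hs hq hR hQ α hα0]
    exact hellinger_le_one μ s q hs hq (lint_one μ R s hR) (lint_one μ Q q hQ) α hα0 hα
  have hH1 : hellingerInt α P R ≤ 1 := by
    rw [hellinger_eq μ P R p s hp hs hP hR α hα0]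
    exact hellinger_le_one μ p s hp hs (lint_one μ P p hP) (lint_one μ R s hR) α hα0 hα
  have hA : hellingerInt α R Q ≠ ⊤ := ne_top_of_le_ne_top ENNReal.one_ne_top hA1
  have hH : hellingerInt α P R ≠ ⊤ := ne_top_of_le_ne_top ENNReal.one_ne_top hH1
  suffices h : hellingerInt α P Q ≤ hellingerInt α P R * hellingerInt α R Q by
    rw [renyiSimple_lt_eq, renyiSimple_lt_eq, renyiSimple_lt_eq]
    have hc : 0 < (1 - α)⁻¹ := inv_pos.2 (by linarith)
    have h2 := (ereal_pos_mul_iff hc _ _).2 (ENNReal.log_le_log h)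
    rw [ENNReal.log_mul_add, EReal.left_distrib_of_nonneg_of_ne_top (by exact_mod_cast hc.le)
      (EReal.coe_ne_top _)] at h2
    refine le_trans (le_of_eq ?_) (EReal.neg_le_neg_iff.2 h2)
    have hnt : ∀ h : ℝ≥0∞, h ≤ 1 → (((1 - α)⁻¹ : ℝ) : EReal) * ENNReal.log h ≠ ⊤ := by
      intro h hh
      have : (((1 - α)⁻¹ : ℝ) : EReal) * ENNReal.log h ≤ (((1 - α)⁻¹ : ℝ) : EReal) * 0 :=
        (ereal_pos_mul_iff hc _ _).2 (ENNReal.log_le_zero_iff.2 hh)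
      rw [mul_zero] at this
      exact ne_top_of_le_ne_top EReal.zero_ne_top this
    rw [EReal.neg_add (Or.inr (hnt _ hA1)) (Or.inl (hnt _ hH1))]; exact (sub_eq_add_neg _ _).symm
  by_cases hA0 : hellingerInt α R Q = 0
  · rw [hA0] at hmin0 ⊢
    simpa using hmin0
  have hB : hellingerInt α P Q ≠ ⊤ := ne_top_of_le_ne_top hA hmin0
  set a := (hellingerInt α R Q).toReal with ha
  set b := (hellingerInt α P Q).toReal with hb
  have ea : hellingerInt α R Q = ENNReal.ofReal a := (ENNReal.ofReal_toReal hA).symm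
  have eb : hellingerInt α P Q = ENNReal.ofReal b := (ENNReal.ofReal_toReal hB).symm
  have apos : 0 < a := ENNReal.toReal_pos hA0 hA
  have bnn : 0 ≤ b := ENNReal.toReal_nonneg
  have hab : b ≤ a := ENNReal.toReal_mono hA hmin0
  have hC : b / a ≤ 1 := by rw [div_le_one apos]; linarith
  have key : ENNReal.ofReal (b / a) ≤ hellingerInt α P R := by
    rw [hellinger_eq μ P R p s hp hs hP hR α hα0]
    apply core_lt μ hα0 hα s p hs hp (lint_one μ R s hR) (lint_one μ P p hP) _ (by positivity) hC
    intro t t0 t1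
    have hl : (1 - t).toNNReal + t.toNNReal = 1 := by
      rw [← Real.toNNReal_add (by linarith) t0.le]; simp
    obtain ⟨z, z0, hz, hh⟩ := mix_hellinger μ P R Q p s q hp hs hq hP hR hQ α hα0
      (1 - t).toNNReal t.toNNReal (hprob _ _ hl)
    have hm := (renyiSimple_le_lt hα _ _ _ _).1 (hmin _ _ hl)
    have h1 := mul_le_mul_right hm ((z ^ α : ℝ≥0) : ℝ≥0∞)
    rw [hh, ea, eb] at h1
    rw [hz, ← ENNReal.ofReal_coe_nnreal]
    apply ENNReal.ofReal_le_ofReal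
    change ENNReal.ofReal (1 - t) * _ + ENNReal.ofReal t * _ ≤ _ at h1
    rw [← ENNReal.ofReal_coe_nnreal, ← ENNReal.ofReal_mul (by linarith), ← ENNReal.ofReal_mul t0.le,
      ← ENNReal.ofReal_mul (by positivity),
      ← ENNReal.ofReal_add (mul_nonneg (by linarith) apos.le) (mul_nonneg t0.le (by linarith))] at h1
    have h2 := (ENNReal.ofReal_le_ofReal_iff (by positivity)).1 h1
    have hq0 : 0 ≤ b / a := by positivity
    have h3 : 1 + t * (b / a - 1) ≤ (z : ℝ) ^ α := by
      have : 1 + t * (b / a - 1) = ((1 - t) * a + t * b) / a := by field_simp; ring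
      rw [this, div_le_iff₀ apos]
      simpa using h2
    have hpos : -1 ≤ t * (b / a - 1) := by nlinarith
    have h4 : (1 + t * (b / a - 1)) ^ (1 / α) ≤ (z : ℝ) := by
      rw [← rpow_one_div_cancel' hα0 z.coe_nonneg]
      exact Real.rpow_le_rpow (by linarith) h3 (by positivity)
    have h5 := one_add_mul_self_le_rpow_one_add hpos hinv.le
    refine (le_of_eq ?_).trans (h5.trans h4)
    ring
  calc _ = ENNReal.ofReal (b / a) * ENNReal.ofReal a := by
        rw [← ENNReal.ofReal_mul (by positivity), eb]; congr 1; field_simp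
    _ ≤ _ := by rw [← ea]; gcongr

/-- pointwise Kullback-Leibler integrand -/
noncomputable def kphi (p q : ℝ≥0) : ℝ≥0∞ :=
  if q = 0 then (if p = 0 then 0 else ⊤) else ENNReal.ofReal (p * Real.log (p / q) - p + q)

lemma kphi_meas {X : Type*} [MeasurableSpace X] (p q : X → ℝ≥0)
    (hp : Measurable p) (hq : Measurable q) : Measurable (fun x => kphi (p x) (q x)) := by
  unfold kphi
  refine Measurable.ite (hq (measurableSet_singleton 0)) ?_ (by fun_prop)
  exact Measurable.ite (hp (measurableSet_singleton 0)) measurable_const measurable_const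

lemma klr_nonneg {x y : ℝ} (hx : 0 ≤ x) (hy : 0 < y) : 0 ≤ x * Real.log (x / y) - x + y := by
  rcases hx.eq_or_lt with h | h
  · rw [← h]; simp [hy.le]
  · have h1 := Real.log_le_sub_one_of_pos (div_pos hy h)
    have h2 : Real.log (x / y) = - Real.log (y / x) := by rw [← Real.log_inv, inv_div]
    have h3 := mul_le_mul_of_nonneg_left h1 h.le
    have h4 : x * (y / x - 1) = y - x := by field_simp
    rw [h2]; linarith

/-- approximating integrand -/
noncomputable def kapp (a : ℝ) (p q : ℝ≥0) : ℝ :=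
  (a * p + (1 - a) * q - (p : ℝ) ^ a * (q : ℝ) ^ (1 - a)) / (1 - a)

lemma kapp_nonneg {a : ℝ} (h0 : 0 < a) (h1 : a < 1) (p q : ℝ≥0) : 0 ≤ kapp a p q := by
  unfold kapp
  have := Real.geom_mean_le_arith_mean2_weighted h0.le (show 0 ≤ 1 - a by linarith)
    p.coe_nonneg q.coe_nonneg (by ring)
  exact div_nonneg (by linarith) (by linarith)

lemma rpow_exp_form {p q a : ℝ} (hp : 0 < p) (hq : 0 < q) :
    p ^ a * q ^ (1 - a) = p * Real.exp ((a - 1) * Real.log (p / q)) := by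
  rw [Real.rpow_def_of_pos hp, Real.rpow_def_of_pos hq, ← Real.exp_add, Real.log_div hp.ne' hq.ne']
  nth_rw 2 [← Real.exp_log hp]
  rw [← Real.exp_add]; congr 1; ring

lemma kapp_le {a : ℝ} (h0 : 0 < a) (h1 : a < 1) (p q : ℝ≥0) :
    ENNReal.ofReal (kapp a p q) ≤ kphi p q := by
  have h1' : 0 < 1 - a := by linarith
  unfold kphi kapp
  split_ifs with hq hp
  · subst hq; subst hp; simp [Real.zero_rpow h0.ne']
  · simp
  · apply ENNReal.ofReal_le_ofReal
    have hq' : (0:ℝ) < q := by positivity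
    by_cases hp : p = 0
    · subst hp
      simp only [NNReal.coe_zero, Real.zero_rpow h0.ne']
      rw [div_le_iff₀ h1']; simp; linarith
    · have hp' : (0:ℝ) < p := by positivity
      rw [rpow_exp_form hp' hq', div_le_iff₀ h1']
      have := mul_le_mul_of_nonneg_left (Real.add_one_le_exp ((a - 1) * Real.log (p / q))) hp'.le
      nlinarith

lemma kapp_tendsto (p q : ℝ≥0) :
    Tendsto (fun a => ENNReal.ofReal (kapp a p q)) (𝓝[<] 1) (𝓝 (kphi p q)) := by
  have hev : ∀ᶠ a in 𝓝[<] (1:ℝ), 0 < a ∧ a < 1 := by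
    filter_upwards [Ioo_mem_nhdsLT (zero_lt_one : (0:ℝ) < 1)] with t ht using ht
  have hinv : Tendsto (fun a : ℝ => (1 - a)⁻¹) (𝓝[<] 1) atTop := by
    apply tendsto_inv_nhdsGT_zero.comp
    rw [tendsto_nhdsWithin_iff]
    refine ⟨?_, ?_⟩
    · have : Tendsto (fun a : ℝ => 1 - a) (𝓝 1) (𝓝 (1 - 1)) := by
        apply Continuous.tendsto; fun_prop
      rw [sub_self] at this
      exact this.mono_left nhdsWithin_le_nhds
    · filter_upwards [hev] with a ha
      simp; exact ha.2
  unfold kphi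
  split_ifs with hq hp
  · subst hq; subst hp
    refine tendsto_const_nhds.congr' ?_
    filter_upwards [hev] with a ha
    simp [kapp, Real.zero_rpow ha.1.ne']
  · subst hq
    apply ENNReal.tendsto_ofReal_atTop.comp
    have hp' : (0:ℝ) < p := by positivity
    have h1 : Tendsto (fun a : ℝ => a * p) (𝓝[<] 1) (𝓝 (1 * p)) :=
      Tendsto.mono_left (by apply Continuous.tendsto (f := fun a : ℝ => a * p); fun_prop) nhdsWithin_le_nhds
    have h2 := h1.pos_mul_atTop (by simpa using hp') hinv
    refine h2.congr' ?_
    filter_upwards [hev] with a ha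
    simp only [kapp, NNReal.coe_zero]
    rw [Real.zero_rpow (by linarith [ha.2])]; ring
  · apply ENNReal.tendsto_ofReal
    have hq' : (0:ℝ) < q := by positivity
    by_cases hp : p = 0
    · subst hp
      refine tendsto_const_nhds.congr' ?_
      filter_upwards [hev] with a ha
      have : 1 - a ≠ 0 := by linarith [ha.2]
      simp only [kapp, NNReal.coe_zero, Real.zero_rpow ha.1.ne']
      field_simp; simp
    · have hp' : (0:ℝ) < p := by positivity
      set L := Real.log (p / q) with hL
      have hd : HasDerivAt (fun a : ℝ => (p:ℝ) * Real.exp ((a - 1) * L)) (p * L) 1 := by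
        have h1 : HasDerivAt (fun a : ℝ => (a - 1) * L) (1 * L) 1 :=
          ((hasDerivAt_id (1:ℝ)).sub_const 1).mul_const L
        have h2 := h1.exp.const_mul (p : ℝ)
        simpa using h2
      have hs := (hasDerivAt_iff_tendsto_slope.1 hd).mono_left
        (nhdsWithin_mono 1 (show Set.Iio (1:ℝ) ⊆ {1}ᶜ by intro x hx; exact ne_of_lt hx))
      have h3 := (hs.sub_const (p : ℝ)).add_const (q : ℝ)
      refine h3.congr' ?_
      filter_upwards [hev] with a ha
      have h1a : 1 - a ≠ 0 := by linarith [ha.2]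
      have h1b : a - 1 ≠ 0 := by linarith [ha.2]
      rw [slope_def_field, kapp, rpow_exp_form hp' hq', ← hL]
      simp only [sub_self, zero_mul, Real.exp_zero, mul_one]
      rw [eq_div_iff h1a]
      have : (p * Real.exp ((a - 1) * L) - p) / (a - 1) * (1 - a) = p - p * Real.exp ((a - 1) * L) := by
        field_simp; ring
      linear_combination this

lemma kapp_meas {X : Type*} [MeasurableSpace X] (p q : X → ℝ≥0)
    (hp : Measurable p) (hq : Measurable q) (a : ℝ) :
    Measurable (fun x => ENNReal.ofReal (kapp a (p x) (q x))) := by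
  unfold kapp; fun_prop

lemma hell_kapp {X : Type*} [MeasurableSpace X] (μ : Measure X)
    (p q : X → ℝ≥0) (hp : Measurable p) (hq : Measurable q)
    (ip : ∫⁻ x, (p x : ℝ≥0∞) ∂μ = 1) (iq : ∫⁻ x, (q x : ℝ≥0∞) ∂μ = 1) {a : ℝ} (ha : 0 < a)
    (ha1 : a < 1) :
    ENNReal.ofReal (1 - a) * ∫⁻ x, ENNReal.ofReal (kapp a (p x) (q x)) ∂μ +
      ∫⁻ x, (p x : ℝ≥0∞) ^ a * (q x : ℝ≥0∞) ^ (1 - a) ∂μ = 1 := by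
  have h1' : 0 < 1 - a := by linarith
  rw [← lintegral_const_mul _ (kapp_meas p q hp hq a),
    ← lintegral_add_left ((kapp_meas p q hp hq a).const_mul _)]
  have : ∀ x, ENNReal.ofReal (1 - a) * ENNReal.ofReal (kapp a (p x) (q x)) +
      (p x : ℝ≥0∞) ^ a * (q x : ℝ≥0∞) ^ (1 - a) =
      ENNReal.ofReal a * p x + ENNReal.ofReal (1 - a) * q x := by
    intro x
    have := kapp_nonneg ha ha1 (p x) (q x)
    rw [← ENNReal.ofReal_coe_nnreal, ← ENNReal.ofReal_coe_nnreal,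
      ENNReal.ofReal_rpow_of_nonneg (by positivity) ha.le,
      ENNReal.ofReal_rpow_of_nonneg (by positivity) (by linarith),
      ← ENNReal.ofReal_mul (by positivity), ← ENNReal.ofReal_mul (by positivity),
      ← ENNReal.ofReal_mul (by positivity), ← ENNReal.ofReal_mul (by positivity),
      ← ENNReal.ofReal_add (by positivity) (by positivity),
      ← ENNReal.ofReal_add (by positivity) (by positivity)]
    congr 1
    unfold kapp
    field_simp; ring
  simp_rw [this]
  rw [lintegral_add_left (by fun_prop), lintegral_const_mul _ hp.coe_nnreal_ennreal,
    lintegral_const_mul _ hq.coe_nnreal_ennreal, ip, iq, mul_one, mul_one,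
    ← ENNReal.ofReal_add ha.le h1'.le]
  simp

lemma renyiDiv_one {X : Type*} [MeasurableSpace X] (μ : Measure X) [SigmaFinite μ]
    (P Q : Measure X) [IsProbabilityMeasure P] [IsProbabilityMeasure Q]
    (p q : X → ℝ≥0) (hp : Measurable p) (hq : Measurable q)
    (hP : P = μ.withDensity (fun x => (p x : ℝ≥0∞)))
    (hQ : Q = μ.withDensity (fun x => (q x : ℝ≥0∞))) :
    renyiDiv 1 P Q = ((∫⁻ x, kphi (p x) (q x) ∂μ : ℝ≥0∞) : EReal) := by
  have hdef : renyiDiv 1 P Q = limsup (fun a : ℝ => renyiSimple a P Q) (𝓝[<] 1) := by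
    unfold renyiDiv; simp
  have ip := lint_one μ P p hP
  have iq := lint_one μ Q q hQ
  have hev : ∀ᶠ a in 𝓝[<] (1:ℝ), 0 < a ∧ a < 1 := by
    filter_upwards [Ioo_mem_nhdsLT (zero_lt_one : (0:ℝ) < 1)] with t ht using ht
  set I : ℝ → ℝ≥0∞ := fun a => ∫⁻ x, ENNReal.ofReal (kapp a (p x) (q x)) ∂μ with hI
  have hform : ∀ a, 0 < a → a < 1 → ENNReal.ofReal (1 - a) * I a + hellingerInt a P Q = 1 := by
    intro a h0 h1
    rw [hellinger_eq μ P Q p q hp hq hP hQ a h0]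
    exact hell_kapp μ p q hp hq ip iq h0 h1
  rw [hdef]
  apply le_antisymm
  · by_cases hK : ∫⁻ x, kphi (p x) (q x) ∂μ = ⊤
    · rw [hK]; exact le_top
    set k := (∫⁻ x, kphi (p x) (q x) ∂μ).toReal with hk
    have ek : ∫⁻ x, kphi (p x) (q x) ∂μ = ENNReal.ofReal k := (ENNReal.ofReal_toReal hK).symm
    have hk0 : 0 ≤ k := ENNReal.toReal_nonneg
    rw [ek, EReal.coe_ennreal_ofReal, max_eq_left hk0]
    have hd : HasDerivAt (fun a : ℝ => Real.log (1 - (1 - a) * k)) k 1 := by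
      have h1 : HasDerivAt (fun a : ℝ => 1 - (1 - a) * k) (-(-1 * k)) 1 :=
        (((hasDerivAt_id (1:ℝ)).const_sub 1).mul_const k).const_sub 1
      have h2 := h1.log (by simp)
      simpa using h2
    have hs := (hasDerivAt_iff_tendsto_slope.1 hd).mono_left
        (nhdsWithin_mono 1 (show Set.Iio (1:ℝ) ⊆ {1}ᶜ by intro x hx; exact ne_of_lt hx))
    have hs2 : Tendsto (fun a : ℝ => ((slope (fun a : ℝ => Real.log (1 - (1 - a) * k)) 1 a : ℝ) : EReal))
      (𝓝[<] 1) (𝓝 (k : EReal)) := (continuous_coe_real_ereal.tendsto k).comp hs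
    rw [← hs2.limsup_eq]
    refine limsup_le_limsup ?_
    · have hpos : ∀ᶠ a in 𝓝[<] (1:ℝ), 0 < 1 - (1 - a) * k := by
        have : Tendsto (fun a : ℝ => 1 - (1 - a) * k) (𝓝[<] 1) (𝓝 (1 - (1 - 1) * k)) :=
          Tendsto.mono_left (by
            apply Continuous.tendsto (f := fun a : ℝ => 1 - (1 - a) * k); fun_prop) nhdsWithin_le_nhds
        exact this.eventually (lt_mem_nhds (by simp))
      filter_upwards [hev, hpos] with a ⟨h0, h1⟩ hpos
      have h1' : 0 < 1 - a := by linarith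
      have hle : ENNReal.ofReal (1 - (1 - a) * k) ≤ hellingerInt a P Q := by
        have hIk : I a ≤ ENNReal.ofReal k := by
          rw [← ek]; exact lintegral_mono (fun x => kapp_le h0 h1 _ _)
        have h3 := hform a h0 h1
        have h4 : ENNReal.ofReal (1 - a) * ENNReal.ofReal k + ENNReal.ofReal (1 - (1 - a) * k) = 1 := by
          rw [← ENNReal.ofReal_mul h1'.le, ← ENNReal.ofReal_add (by positivity) hpos.le]; simp
        have h5 : ENNReal.ofReal (1 - a) * ENNReal.ofReal k + ENNReal.ofReal (1 - (1 - a) * k) ≤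
            ENNReal.ofReal (1 - a) * ENNReal.ofReal k + hellingerInt a P Q := by
          rw [h4, ← h3]; gcongr
        exact (ENNReal.add_le_add_iff_left (ENNReal.mul_ne_top ENNReal.ofReal_ne_top
          ENNReal.ofReal_ne_top)).1 h5
      have h6 := ENNReal.log_le_log hle
      rw [ENNReal.log_ofReal_of_pos hpos] at h6
      have h7 := (ereal_pos_mul_iff (inv_pos.2 h1') _ _).2 h6
      rw [renyiSimple_lt_eq]
      refine (EReal.neg_le_neg_iff.2 h7).trans (le_of_eq ?_)
      rw [← EReal.coe_mul, ← EReal.coe_neg, slope_def_field]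
      congr 1
      have : a - 1 ≠ 0 := by linarith
      simp only [sub_self, zero_mul, sub_zero, Real.log_one]
      rw [eq_div_iff this]; field_simp; ring
  · have fatou := lintegral_liminf_le (μ := μ) (u := 𝓝[<] (1:ℝ)) (kapp_meas p q hp hq)
    simp_rw [(fun x => (kapp_tendsto (p x) (q x)).liminf_eq)] at fatou
    have h2 : ((liminf I (𝓝[<] (1:ℝ)) : ℝ≥0∞) : EReal) =
        liminf (fun a => ((I a : ℝ≥0∞) : EReal)) (𝓝[<] (1:ℝ)) := by
      exact (Monotone.map_liminf_of_continuousAt (f := fun x : ℝ≥0∞ => (x : EReal))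
        EReal.coe_ennreal_strictMono.monotone I
        continuous_coe_ennreal_ereal.continuousAt)
    calc _ ≤ ((liminf I (𝓝[<] (1:ℝ)) : ℝ≥0∞) : EReal) := by
          exact_mod_cast fatou
      _ ≤ liminf (fun a : ℝ => renyiSimple a P Q) (𝓝[<] 1) := by
          rw [h2]
          refine liminf_le_liminf ?_
          filter_upwards [hev] with a ⟨h0, h1⟩
          have h1' : 0 < 1 - a := by linarith
          have h3 := hform a h0 h1
          have hIt : I a ≠ ⊤ := by
            intro h; rw [h, ENNReal.mul_top (by simpa using h1')] at h3; simp at h3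
          have hHt : hellingerInt a P Q ≠ ⊤ := by
            intro h; rw [h] at h3; simp at h3
          rw [renyiSimple_lt_eq]
          by_cases hH0 : hellingerInt a P Q = 0
          · rw [hH0, ENNReal.log_zero, EReal.coe_mul_bot_of_pos (inv_pos.2 h1')]; simp
          · rw [ENNReal.log_pos_real hH0 hHt]
            have hh : 0 < (hellingerInt a P Q).toReal := ENNReal.toReal_pos hH0 hHt
            have h4 := congrArg ENNReal.toReal h3
            rw [ENNReal.toReal_add (ENNReal.mul_ne_top ENNReal.ofReal_ne_top hIt) hHt,
              ENNReal.toReal_mul, ENNReal.toReal_ofReal h1'.le, ENNReal.toReal_one] at h4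
            have h5 := Real.log_le_sub_one_of_pos hh
            rw [← EReal.coe_mul, ← EReal.coe_neg, ← EReal.coe_ennreal_toReal hIt, EReal.coe_le_coe_iff]
            rw [← mul_neg, le_inv_mul_iff₀ h1']
            linarith
      _ ≤ _ := liminf_le_limsup

lemma kphi_mix (t : ℝ) (t0 : 0 < t) (t1 : t < 1) (s p q : ℝ≥0) :
    kphi ((1 - t).toNNReal * s + t.toNNReal * p) q +
      ENNReal.ofReal t * kphi p ((1 - t).toNNReal * s + t.toNNReal * p) ≤
    ENNReal.ofReal (1 - t) * kphi s q + ENNReal.ofReal t * kphi p q := by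
  have t1' : 0 < 1 - t := by linarith
  set m := (1 - t).toNNReal * s + t.toNNReal * p with hm
  have hm' : (m : ℝ) = (1 - t) * s + t * p := by
    rw [hm]; push_cast; rw [Real.coe_toNNReal _ t1'.le, Real.coe_toNNReal _ t0.le]
  by_cases h0 : s = 0 ∧ p = 0
  · obtain ⟨rfl, rfl⟩ := h0
    have : m = 0 := by simp [hm]
    rw [this]
    have h2 : kphi 0 0 = 0 := by simp [kphi]
    rw [h2, ← add_mul, ← ENNReal.ofReal_add t1'.le t0.le]; simp
  · by_cases hq : q = 0
    · subst hq
      have : ENNReal.ofReal (1 - t) * kphi s 0 + ENNReal.ofReal t * kphi p 0 = ⊤ := by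
        by_cases hs : s = 0
        · have hp : p ≠ 0 := fun h => h0 ⟨hs, h⟩
          simp [kphi, hp, ENNReal.mul_top, t0]
        · have : ¬ (t ≥ 1) := by linarith
          simp [kphi, hs, ENNReal.mul_top, t1]
      rw [this]; exact le_top
    · have hq' : (0:ℝ) < q := by positivity
      have hs0 := s.coe_nonneg
      have hp0 := p.coe_nonneg
      have hmpos : (0:ℝ) < m := by
        rw [hm']
        by_cases hs : s = 0
        · have hp : p ≠ 0 := fun h => h0 ⟨hs, h⟩
          have : (0:ℝ) < p := by positivity
          positivity
        · have : (0:ℝ) < s := by positivity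
          positivity
      have hmne : m ≠ 0 := by intro h; simp [h] at hmpos
      simp only [kphi, hq, hmne, if_false]
      have n1 := klr_nonneg m.coe_nonneg hq'
      have n2 := klr_nonneg p.coe_nonneg hmpos
      have n3 := klr_nonneg s.coe_nonneg hq'
      have n4 := klr_nonneg p.coe_nonneg hq'
      have n5 := klr_nonneg s.coe_nonneg hmpos
      rw [← ENNReal.ofReal_mul t0.le, ← ENNReal.ofReal_mul t1'.le, ← ENNReal.ofReal_mul t0.le,
        ← ENNReal.ofReal_add n1 (by positivity), ← ENNReal.ofReal_add (by positivity) (by positivity)]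
      apply ENNReal.ofReal_le_ofReal
      have hlog : ∀ x : ℝ, 0 ≤ x → ∀ y : ℝ, 0 < y → x * Real.log (x / y) = x * Real.log x - x * Real.log y := by
        intro x hx y hy
        rcases hx.eq_or_lt with h | h
        · rw [← h]; simp
        · rw [Real.log_div h.ne' hy.ne']; ring
      rw [hlog _ hs0 _ hmpos] at n5
      rw [hlog _ m.coe_nonneg _ hq', hlog _ hs0 _ hq', hlog _ hp0 _ hq', hlog _ hp0 _ hmpos]
      have n6 := mul_nonneg t1'.le n5
      generalize Real.log m = lm at *
      rw [hm'] at n6 ⊢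
      nlinarith

lemma kphi_tendsto (s p : ℝ≥0) :
    Tendsto (fun t : ℝ => kphi p ((1 - t).toNNReal * s + t.toNNReal * p)) (𝓝[>] 0)
      (𝓝 (kphi p s)) := by
  have hc : Tendsto (fun t : ℝ => (1 - t) * s + t * p) (𝓝[>] 0) (𝓝 ((1 - 0) * (s:ℝ) + 0 * p)) :=
    Tendsto.mono_left (by
      apply Continuous.tendsto (f := fun t : ℝ => (1 - t) * (s:ℝ) + t * p); fun_prop) nhdsWithin_le_nhds
  have hm : ∀ t : ℝ, 0 < t → t < 1 →
      (((1 - t).toNNReal * s + t.toNNReal * p : ℝ≥0) : ℝ) = (1 - t) * s + t * p := by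
    intro t t0 t1
    push_cast; rw [Real.coe_toNNReal _ (by linarith), Real.coe_toNNReal _ t0.le]
  by_cases hs : s = 0
  · subst hs
    by_cases hp : p = 0
    · subst hp; simp
    · have hp' : (0:ℝ) < p := by positivity
      have e : kphi p 0 = ⊤ := by simp [kphi, hp]
      rw [e]
      have h1 : Tendsto (fun t : ℝ => (-Real.log t) * p + (- (p:ℝ))) (𝓝[>] 0) atTop := by
        apply tendsto_atTop_add_const_right
        exact (tendsto_neg_atBot_atTop.comp Real.tendsto_log_nhdsGT_zero).atTop_mul_const hp'
      have h2 := ENNReal.tendsto_ofReal_atTop.comp h1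
      refine tendsto_nhds_top_mono h2 ?_
      filter_upwards [nhdsGT_unit] with t ⟨t0, t1⟩
      have hne : (1 - t).toNNReal * 0 + t.toNNReal * p ≠ 0 := by
        simp [hp, t0]
      simp only [kphi, hne, if_false, Function.comp]
      apply ENNReal.ofReal_le_ofReal
      rw [hm t t0 t1]
      have : (p:ℝ) / ((1 - t) * ((0:ℝ≥0):ℝ) + t * p) = t⁻¹ := by
        simp only [NNReal.coe_zero]; field_simp; simp
      rw [this, Real.log_inv]
      have := mul_nonneg t0.le hp'.le
      simp only [NNReal.coe_zero]
      linarith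
  · have hs' : (0:ℝ) < s := by positivity
    simp only [sub_zero, one_mul, zero_mul, add_zero] at hc
    have e : kphi p s = ENNReal.ofReal (p * Real.log (p / s) - p + s) := by simp [kphi, hs]
    rw [e]
    have h1 : Tendsto (fun t : ℝ => ENNReal.ofReal
        (p * Real.log (p / ((1 - t) * s + t * p)) - p + ((1 - t) * s + t * p))) (𝓝[>] 0)
        (𝓝 (ENNReal.ofReal (p * Real.log (p / s) - p + s))) := by
      apply ENNReal.tendsto_ofReal
      apply Tendsto.add _ hc
      apply Tendsto.sub_const
      by_cases hp : p = 0
      · subst hp; simp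
      · have hp' : (0:ℝ) < p := by positivity
        apply Tendsto.const_mul
        exact (tendsto_const_nhds.div hc hs'.ne').log (div_pos hp' hs').ne'
    refine h1.congr' ?_
    filter_upwards [nhdsGT_unit] with t ⟨t0, t1⟩
    have hne : (1 - t).toNNReal * s + t.toNNReal * p ≠ 0 := by
      simp [hs, t1]
    simp only [kphi, hne, if_false]
    rw [hm t t0 t1]

lemma case_one {X : Type*} [MeasurableSpace X]
    (P R Q : Measure X) [IsProbabilityMeasure P] [IsProbabilityMeasure R] [IsProbabilityMeasure Q]
    (hprob : ∀ l₁ l₂ : ℝ≥0, l₁ + l₂ = 1 → IsProbabilityMeasure (alphaMix 1 l₁ l₂ R P))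
    (hmin0 : renyiDiv 1 R Q ≤ renyiDiv 1 P Q)
    (hmin : ∀ l₁ l₂ : ℝ≥0, l₁ + l₂ = 1 →
      renyiDiv 1 R Q ≤ renyiDiv 1 (alphaMix 1 l₁ l₂ R P) Q) :
    renyiDiv 1 P R + renyiDiv 1 R Q ≤ renyiDiv 1 P Q := by
  set μ := P + R + Q with hμ
  obtain ⟨p, hp, hP⟩ := exists_dens P μ (Measure.absolutelyContinuous_of_le
    (by rw [hμ, add_assoc]; exact Measure.le_add_right le_rfl))
  obtain ⟨s, hs, hR⟩ := exists_dens R μ (Measure.absolutelyContinuous_of_le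
    (by rw [hμ]; exact Measure.le_add_right (Measure.le_add_left le_rfl)))
  obtain ⟨q, hq, hQ⟩ := exists_dens Q μ (Measure.absolutelyContinuous_of_le
    (by rw [hμ]; exact Measure.le_add_left le_rfl))
  have ip := lint_one μ P p hP
  have is := lint_one μ R s hR
  rw [renyiDiv_one μ R Q s q hs hq hR hQ] at hmin0 hmin ⊢
  rw [renyiDiv_one μ P Q p q hp hq hP hQ] at hmin0 ⊢
  rw [renyiDiv_one μ P R p s hp hs hP hR]
  have hmin0 := EReal.coe_ennreal_le_coe_ennreal_iff.1 hmin0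
  rw [← EReal.coe_ennreal_add, EReal.coe_ennreal_le_coe_ennreal_iff]
  set A := ∫⁻ x, kphi (s x) (q x) ∂μ with hA
  set B := ∫⁻ x, kphi (p x) (q x) ∂μ with hB
  by_cases hBt : B = ⊤
  · rw [hBt]; exact le_top
  have hAt : A ≠ ⊤ := ne_top_of_le_ne_top hBt hmin0
  set M : ℝ → X → ℝ≥0 := fun t x => (1 - t).toNNReal * s x + t.toNNReal * p x with hM
  have mM : ∀ t, Measurable (M t) := fun t => (hs.const_mul _).add (hp.const_mul _)
  have bound : ∀ᶠ t in 𝓝[>] (0:ℝ), ∫⁻ x, kphi (p x) (M t x) ∂μ ≤ B - A := by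
    filter_upwards [nhdsGT_unit] with t ⟨t0, t1⟩
    have t1' : 0 < 1 - t := by linarith
    have hl : (1 - t).toNNReal + t.toNNReal = 1 := by
      rw [← Real.toNNReal_add (by linarith) t0.le]; simp
    have := hprob _ _ hl
    obtain ⟨z, z0, hz, hm⟩ := mix_dens μ R P s p hs hp hR hP 1 one_pos
      (1 - t).toNNReal t.toNNReal inferInstance
    have em : ∀ x, mixd 1 (1 - t).toNNReal t.toNNReal (s x) (p x) = M t x := by
      intro x; simp [mixd, hM]
    simp_rw [em] at hz hm
    have hz1 : z = 1 := by
      have : ∫⁻ x, (M t x : ℝ≥0∞) ∂μ = 1 := by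
        simp only [hM, ENNReal.coe_add, ENNReal.coe_mul]
        rw [lintegral_add_left (by fun_prop), lintegral_const_mul _ hs.coe_nnreal_ennreal,
          lintegral_const_mul _ hp.coe_nnreal_ennreal, is, ip, mul_one, mul_one]
        exact_mod_cast hl
      rw [hz] at this; exact_mod_cast this
    rw [hz1] at hm
    simp only [inv_one, one_mul] at hm
    have h1 := hmin _ _ hl
    rw [renyiDiv_one μ _ Q (M t) q (mM t) hq hm hQ, EReal.coe_ennreal_le_coe_ennreal_iff] at h1
    have h2 := lintegral_mono (μ := μ) (fun x => kphi_mix t t0 t1 (s x) (p x) (q x))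
    have mk1 := kphi_meas (M t) q (mM t) hq
    have mk2 := kphi_meas p (M t) hp (mM t)
    rw [lintegral_add_left mk1, lintegral_const_mul _ mk2,
      lintegral_add_left ((kphi_meas s q hs hq).const_mul _), lintegral_const_mul _ (kphi_meas s q hs hq),
      lintegral_const_mul _ (kphi_meas p q hp hq)] at h2
    have h3 : A + ENNReal.ofReal t * ∫⁻ x, kphi (p x) (M t x) ∂μ ≤
        ENNReal.ofReal (1 - t) * A + ENNReal.ofReal t * B := le_trans (by gcongr) h2
    have hAs : A = ENNReal.ofReal (1 - t) * A + ENNReal.ofReal t * A := by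
      rw [← add_mul, ← ENNReal.ofReal_add t1'.le t0.le]; simp
    nth_rw 1 [hAs] at h3
    rw [add_assoc, ENNReal.add_le_add_iff_left (ENNReal.mul_ne_top ENNReal.ofReal_ne_top hAt),
      ← mul_add] at h3
    have h4 := (ENNReal.mul_le_mul_iff_right (by simpa using t0) ENNReal.ofReal_ne_top).1 h3
    exact ENNReal.le_sub_of_add_le_left hAt h4
  have fatou := lintegral_liminf_le (μ := μ) (u := 𝓝[>] (0:ℝ))
    (fun t => kphi_meas p (M t) hp (mM t))
  have hl : ∀ x, liminf (fun t => kphi (p x) (M t x)) (𝓝[>] (0:ℝ)) = kphi (p x) (s x) :=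
    fun x => (kphi_tendsto (s x) (p x)).liminf_eq
  simp_rw [hl] at fatou
  have h5 := fatou.trans (liminf_le_of_frequently_le' bound.frequently)
  calc _ ≤ B - A + A := by gcongr
    _ = B := tsub_add_cancel_of_le hmin0

/-- **Pythagorean inequality.** Let `α ∈ (0,∞)`, let `S` be an `α`-convex set of
probability distributions and let `Q` be an arbitrary probability distribution.  If the
`α`-information projection `P⋆ = argmin_{P ∈ S} D_α(P‖Q)` exists, then
`D_α(P‖Q) ≥ D_α(P‖P⋆) + D_α(P⋆‖Q)` for all `P ∈ S`. -/
theorem renyiDiv_pythagorean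
    {X : Type*} [MeasurableSpace X] (α : ℝ) (hα : 0 < α)
    (S : Set (Measure X)) (hSprob : ∀ P ∈ S, IsProbabilityMeasure P)
    (hSconv : AlphaConvex α S)
    (Q : Measure X) [IsProbabilityMeasure Q]
    (Pstar : Measure X) (hPstarS : Pstar ∈ S)
    (hPstarMin : ∀ P ∈ S,
      renyiDiv (ENNReal.ofReal α) Pstar Q ≤ renyiDiv (ENNReal.ofReal α) P Q) :
    ∀ P ∈ S,
      renyiDiv (ENNReal.ofReal α) P Pstar + renyiDiv (ENNReal.ofReal α) Pstar Q
        ≤ renyiDiv (ENNReal.ofReal α) P Q := by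
  intro P hPS
  have := hSprob P hPS
  have := hSprob Pstar hPstarS
  have hmix : ∀ l₁ l₂ : ℝ≥0, l₁ + l₂ = 1 → alphaMix α l₁ l₂ Pstar P ∈ S := fun l₁ l₂ h =>
    hSconv l₁ l₂ (by exact_mod_cast h) Pstar hPstarS P hPS
  by_cases h1 : α = 1
  · subst h1
    rw [ENNReal.ofReal_one] at *
    exact case_one P Pstar Q (fun l₁ l₂ h => hSprob _ (hmix l₁ l₂ h)) (hPstarMin P hPS)
      (fun l₁ l₂ h => hPstarMin _ (hmix l₁ l₂ h))
  · have e : ∀ P' Q' : Measure X, renyiDiv (ENNReal.ofReal α) P' Q' = renyiSimple α P' Q' := by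
      intro P' Q'
      unfold renyiDiv
      rw [if_neg (by simpa using hα), if_neg (by simpa using h1), if_neg ENNReal.ofReal_ne_top,
        ENNReal.toReal_ofReal hα.le]
    simp only [e] at hPstarMin ⊢
    rcases lt_or_gt_of_ne h1 with h | h
    · exact simple_lt hα h P Pstar Q (fun l₁ l₂ h => hSprob _ (hmix l₁ l₂ h)) (hPstarMin P hPS)
        (fun l₁ l₂ h => hPstarMin _ (hmix l₁ l₂ h))
    · exact simple_gt h P Pstar Q (fun l₁ l₂ h => hSprob _ (hmix l₁ l₂ h)) (hPstarMin P hPS)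
        (fun l₁ l₂ h => hPstarMin _ (hmix l₁ l₂ h))
end

section
/- (Channel capacity equals minimax redundancy.) Let X be a finite set, let Θ be a topological space equipped with its Borel σ-algebra in which every singleton is closed, and let θ ↦ P_θ be a measurable map assigning to each θ ∈ Θ a probability distribution on X, with Θ nonempty. For any α ∈ [0,∞], define the channel capacity C_α = sup_π inf_Q ∫ D_α(P_θ ‖ Q) dπ(θ), where π ranges over probability distributions on Θ and Q over probability distributions on X, and the minimax redundancy R_α = inf_Q sup_{θ∈Θ} D_α(P_θ ‖ Q). Then C_α = R_α. -/
open MeasureTheory Real Filter Set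
open scoped ENNReal NNReal Topology Classical

/-- The canonical conversion `EReal → ℝ≥0∞` (sending negative values to `0` and
`⊤` to `⊤`); it is injective on `[0,∞]`, where Rényi divergences take their values. -/
noncomputable def erealToENNReal (x : EReal) : ℝ≥0∞ :=
  if x = ⊤ then ⊤ else ENNReal.ofReal x.toReal


lemma mm_sep {ι E : Type*} [Fintype ι] [AddCommGroup E] [Module ℝ E]
    (K : Set E) (hKc : Convex ℝ K) (f : ι → E → ℝ≥0∞)
    (hc : ∀ θ, ∀ x ∈ K, ∀ y ∈ K, ∀ s t : ℝ, 0 < s → 0 < t → s + t = 1 →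
      f θ (s • x + t • y) ≤ ENNReal.ofReal s * f θ x + ENNReal.ofReal t * f θ y)
    (q0 : E) (hq0 : q0 ∈ K) (h0 : ∀ θ, f θ q0 ≠ ⊤)
    (cr : ℝ) (hcl : ∀ q ∈ K, ∃ θ, ENNReal.ofReal cr < f θ q) :
    ∃ w : ι → ℝ, (∀ i, 0 ≤ w i) ∧ ∑ i, w i = 1 ∧
      ∀ q ∈ K, (∀ i, f i q ≠ ⊤) → cr ≤ ∑ i, w i * (f i q).toReal := by
  classical
  let A : Set (ι → ℝ) := {v | (∀ i, 0 ≤ v i) ∧ ∃ q ∈ K, ∀ i, f i q ≤ ENNReal.ofReal (v i)}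
  let B : Set (ι → ℝ) := Set.pi univ (fun _ => Set.Iio cr)
  have hBo : IsOpen B := isOpen_set_pi finite_univ (fun _ _ => isOpen_Iio)
  have hBc : Convex ℝ B := convex_pi (fun _ _ => convex_Iio cr)
  have hAc : Convex ℝ A := by
    rw [convex_iff_forall_pos]
    rintro v ⟨hv, q, hq, hvq⟩ v' ⟨hv', q', hq', hvq'⟩ s t hs ht hst
    refine ⟨fun i => ?_, s • q + t • q', hKc hq hq' hs.le ht.le hst, fun i => ?_⟩
    · have := hv i; have := hv' i
      simp only [Pi.add_apply, Pi.smul_apply, smul_eq_mul]; positivity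
    · refine (hc i q hq q' hq' s t hs ht hst).trans ?_
      simp only [Pi.add_apply, Pi.smul_apply, smul_eq_mul]
      rw [ENNReal.ofReal_add (mul_nonneg hs.le (hv i)) (mul_nonneg ht.le (hv' i)),
        ENNReal.ofReal_mul hs.le, ENNReal.ofReal_mul ht.le]
      gcongr
      · exact hvq i
      · exact hvq' i
  have hmem : ∀ q ∈ K, (∀ i, f i q ≠ ⊤) → (fun i => (f i q).toReal) ∈ A := fun q hq hf =>
    ⟨fun i => ENNReal.toReal_nonneg, q, hq, fun i => by rw [ENNReal.ofReal_toReal (hf i)]⟩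
  have hdisj : Disjoint B A := by
    rw [Set.disjoint_left]
    rintro v hvB ⟨hv, q, hq, hvq⟩
    obtain ⟨θ, hθ⟩ := hcl q hq
    have h1 : v θ < cr := hvB θ (mem_univ _)
    exact absurd (hθ.trans_le (hvq θ)) (not_lt.2 (ENNReal.ofReal_le_ofReal h1.le))
  obtain ⟨φ, u, hφB, hφA⟩ := geometric_hahn_banach_open hBc hBo hAc hdisj
  let w : ι → ℝ := fun i => φ (Pi.single i 1)
  have hφ : ∀ v, φ v = ∑ i, w i * v i := by
    intro v
    have := LinearMap.pi_apply_eq_sum_univ (φ : (ι → ℝ) →ₗ[ℝ] ℝ) v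
    simp only [ContinuousLinearMap.coe_coe, smul_eq_mul] at this
    rw [this]
    refine Finset.sum_congr rfl fun i _ => ?_
    rw [mul_comm]
    congr 2
    ext j
    simp [Pi.single_apply, eq_comm]
  have hconst : ∀ x < cr, (∑ i, w i) * x < u := by
    intro x hx
    have := hφB (fun _ => x) (fun _ _ => hx)
    rwa [hφ, ← Finset.sum_mul] at this
  have hw : ∀ i, 0 ≤ w i := by
    intro i
    by_contra! hneg
    set b0 := (∑ i, w i) * (cr - 1)
    have hb0 : b0 < u := hconst _ (by linarith)
    set n := (u - b0) / (- w i)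
    have hn : 0 < n := div_pos (by linarith) (by linarith)
    have := hφB (fun j => (cr - 1) - n * Pi.single (M := fun _ => ℝ) i 1 j) (fun j _ => by
      have : (0:ℝ) ≤ Pi.single (M := fun _ => ℝ) i 1 j := by
        rw [Pi.single_apply]; split_ifs <;> norm_num
      simp only [Set.mem_Iio]
      nlinarith)
    rw [hφ] at this
    simp only [mul_sub, Finset.sum_sub_distrib] at this
    rw [← Finset.sum_mul, ← Finset.sum_mul] at this
    simp only [Pi.single_apply, mul_ite, mul_one, mul_zero, Finset.sum_ite_eq', Finset.mem_univ,
      if_true] at this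
    have e : w i * n = -(u - b0) := by
      have hne := hneg.ne
      simp only [n]; field_simp
    have e2 : b0 = (∑ i, w i) * cr - ∑ i, w i := by simp only [b0]; ring
    linarith
  have hW : 0 < ∑ i, w i := by
    refine lt_of_le_of_ne (Finset.sum_nonneg fun i _ => hw i) (fun h => ?_)
    have hz := (Finset.sum_eq_zero_iff_of_nonneg (fun i _ => hw i)).1 h.symm
    have h1 := hφA _ (hmem q0 hq0 h0)
    have h2 := hconst (cr - 1) (by linarith)
    rw [hφ, Finset.sum_eq_zero (fun i hi => by rw [hz i hi, zero_mul])] at h1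
    rw [← h] at h2
    linarith
  have hcu : (∑ i, w i) * cr ≤ u := by
    by_contra! h
    have := hconst (u / ∑ i, w i) (by rw [div_lt_iff₀ hW]; linarith)
    rw [mul_div_cancel₀ _ hW.ne'] at this
    exact lt_irrefl _ this
  refine ⟨fun i => w i / ∑ i, w i, fun i => div_nonneg (hw i) hW.le, ?_, fun q hq hf => ?_⟩
  · rw [← Finset.sum_div, div_self hW.ne']
  · have h1 := hφA _ (hmem q hq hf)
    rw [hφ] at h1
    simp_rw [div_mul_eq_mul_div]
    rw [← Finset.sum_div, le_div_iff₀ hW]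
    linarith

lemma mm_main {Θ E : Type*} [AddCommGroup E] [Module ℝ E] [TopologicalSpace E]
    (K : Set E) (hK : IsCompact K) (hKc : Convex ℝ K) (f : Θ → E → ℝ≥0∞)
    (hl : ∀ θ, LowerSemicontinuous (f θ))
    (hc : ∀ θ, ∀ x ∈ K, ∀ y ∈ K, ∀ s t : ℝ, 0 < s → 0 < t → s + t = 1 →
      f θ (s • x + t • y) ≤ ENNReal.ofReal s * f θ x + ENNReal.ofReal t * f θ y)
    (q0 : E) (hq0 : q0 ∈ K) (h0 : ∀ θ, f θ q0 ≠ ⊤)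
    (h0' : ∀ θ, ∀ q ∈ K, ∀ s t : ℝ, 0 < s → 0 < t → s + t = 1 → f θ (s • q + t • q0) ≠ ⊤)
    (c : ℝ≥0∞) (hcl : ∀ q ∈ K, ∃ θ, c < f θ q) :
    ∃ (F : Finset Θ) (w : F → ℝ≥0∞), ∑ i, w i = 1 ∧
      ∀ q ∈ K, c ≤ ∑ i, w i * f i q := by
  have hctop : c ≠ ⊤ := by
    obtain ⟨θ, h⟩ := hcl q0 hq0
    exact h.ne_top
  obtain ⟨F, hF⟩ := hK.elim_finite_subcover (fun θ => {q | c < f θ q})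
    (fun θ => (hl θ).isOpen_preimage c) (fun q hq => by
      obtain ⟨θ, h⟩ := hcl q hq
      exact mem_iUnion.2 ⟨θ, h⟩)
  obtain ⟨w, hw, hw1, hwq⟩ := mm_sep (ι := F) K hKc (fun i => f i) (fun i => hc i) q0 hq0
    (fun i => h0 i) c.toReal (fun q hq => by
      have := hF hq
      simp only [mem_iUnion, exists_prop] at this
      obtain ⟨θ, hθ, h⟩ := this
      refine ⟨⟨θ, hθ⟩, ?_⟩
      rwa [ENNReal.ofReal_toReal hctop])
  have key : ∀ q ∈ K, (∀ i : F, f i q ≠ ⊤) → c ≤ ∑ i : F, ENNReal.ofReal (w i) * f i q := by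
    intro q hq hf
    have := ENNReal.ofReal_le_ofReal (hwq q hq hf)
    rw [ENNReal.ofReal_toReal hctop, ENNReal.ofReal_sum_of_nonneg
      (fun i _ => mul_nonneg (hw i) ENNReal.toReal_nonneg)] at this
    refine this.trans (le_of_eq (Finset.sum_congr rfl fun i _ => ?_))
    rw [ENNReal.ofReal_mul (hw i), ENNReal.ofReal_toReal (hf i)]
  refine ⟨F, fun i => ENNReal.ofReal (w i), ?_, fun q hq => ?_⟩
  · rw [← ENNReal.ofReal_sum_of_nonneg (fun i _ => hw i), hw1, ENNReal.ofReal_one]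
  · set A := ∑ i : F, ENNReal.ofReal (w i) * f i q
    set M := ∑ i : F, ENNReal.ofReal (w i) * f i q0
    have hM : M ≠ ⊤ := ENNReal.sum_ne_top.2 fun i _ => ENNReal.mul_ne_top ENNReal.ofReal_ne_top (h0 i)
    have hev : ∀ᶠ ε : ℝ in 𝓝[>] 0, c ≤ A + ENNReal.ofReal ε * M := by
      filter_upwards [Ioo_mem_nhdsGT (show (0:ℝ) < 1 by norm_num)] with ε hε
      have hs : 0 < 1 - ε := by linarith [hε.2]
      refine (key ((1 - ε) • q + ε • q0) (hKc hq hq0 hs.le hε.1.le (by ring))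
        (fun i => h0' i q hq _ _ hs hε.1 (by ring))).trans ?_
      simp only [A, M]
      rw [Finset.mul_sum, ← Finset.sum_add_distrib]
      refine Finset.sum_le_sum fun i _ => ?_
      calc _ ≤ ENNReal.ofReal (w i) * (ENNReal.ofReal (1 - ε) * f i q + ENNReal.ofReal ε * f i q0) := by
            gcongr
            exact hc i q hq q0 hq0 _ _ hs hε.1 (by ring)
        _ ≤ ENNReal.ofReal (w i) * (1 * f i q + ENNReal.ofReal ε * f i q0) := by
            gcongr
            exact ENNReal.ofReal_le_one.2 (by linarith [hε.1])
        _ = _ := by ring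
    have ht : Tendsto (fun ε : ℝ => A + ENNReal.ofReal ε * M) (𝓝[>] 0) (𝓝 (A + 0)) := by
      refine Tendsto.const_add _ ?_
      have : Tendsto (fun ε : ℝ => ENNReal.ofReal ε * M) (𝓝 0) (𝓝 (ENNReal.ofReal 0 * M)) :=
        ENNReal.Tendsto.mul_const (ENNReal.continuous_ofReal.tendsto 0) (Or.inr hM)
      rw [ENNReal.ofReal_zero, zero_mul] at this
      exact this.mono_left nhdsWithin_le_nhds
    rw [add_zero] at ht
    exact ge_of_tendsto ht hev

noncomputable def hH {X : Type*} [Fintype X] (a : ℝ) (p q : X → ℝ≥0∞) : ℝ≥0∞ :=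
  ∑ x, p x ^ a * q x ^ (1 - a)

noncomputable def sS {X : Type*} [Fintype X] (a : ℝ) (p q : X → ℝ≥0∞) : ℝ≥0∞ :=
  ((((a - 1)⁻¹ : ℝ) : EReal) * ENNReal.log (hH a p q)).toENNReal

noncomputable def lF (α : ℝ≥0∞) : Filter ℝ :=
  if α = 0 then 𝓝[>] 0 else if α = 1 then 𝓝[<] 1 else if α = ∞ then atTop else pure α.toReal

noncomputable def gG {X : Type*} [Fintype X] (α : ℝ≥0∞) (p q : X → ℝ≥0∞) : ℝ≥0∞ :=
  limsup (fun a => sS a p q) (lF α)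

instance lF_neBot (α : ℝ≥0∞) : (lF α).NeBot := by
  unfold lF; split_ifs <;> infer_instance

lemma lF_ev (α : ℝ≥0∞) : ∀ᶠ a in lF α, 0 < a ∧ a ≠ 1 := by
  unfold lF; split_ifs with h0 h1 h2
  · filter_upwards [Ioo_mem_nhdsGT (show (0:ℝ) < 1 by norm_num)] with a ha using ⟨ha.1, ha.2.ne⟩
  · filter_upwards [Ioo_mem_nhdsLT (show (0:ℝ) < 1 by norm_num)] with a ha using ⟨ha.1, ha.2.ne⟩
  · filter_upwards [eventually_gt_atTop 1] with a ha using ⟨by linarith, ha.ne'⟩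
  · simp only [eventually_pure]
    refine ⟨ENNReal.toReal_pos h0 h2, fun h => h1 ?_⟩
    rw [← ENNReal.ofReal_toReal h2, h, ENNReal.ofReal_one]

lemma term_eq {p q d e m : ℝ≥0∞} {a : ℝ} (ha : 0 < a) (hp : p ≠ ⊤) (hq : q ≠ ⊤)
    (hm : m = p + q) (hd : d * m = p) (he : e * m = q) :
    d ^ a * e ^ (1 - a) * m = p ^ a * q ^ (1 - a) := by
  have hmt : m ≠ ⊤ := by rw [hm]; exact ENNReal.add_ne_top.2 ⟨hp, hq⟩
  rcases eq_or_ne m 0 with h | h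
  · have : p = 0 := by rw [← hd, h, mul_zero]
    rw [h, mul_zero, this, ENNReal.zero_rpow_of_pos ha, zero_mul]
  · have hdt : d ≠ ⊤ := by
      rintro rfl; rw [ENNReal.top_mul h] at hd; exact hp hd.symm
    have het : e ≠ ⊤ := by
      rintro rfl; rw [ENNReal.top_mul h] at he; exact hq he.symm
    rw [← hd, ← he, ENNReal.mul_rpow_of_ne_top hdt hmt, ENNReal.mul_rpow_of_ne_top het hmt]
    have : m ^ a * m ^ (1 - a) = m := by
      rw [← ENNReal.rpow_add _ _ h hmt]; simp
    calc _ = d ^ a * e ^ (1 - a) * (m ^ a * m ^ (1 - a)) := by rw [this]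
      _ = _ := by ring

lemma hell_eq {X : Type*} [Fintype X] [MeasurableSpace X] [MeasurableSingletonClass X]
    (P Q : Measure X) [IsProbabilityMeasure P] [IsProbabilityMeasure Q] {a : ℝ} (ha : 0 < a) :
    hellingerInt a P Q = hH a (fun x => P {x}) (fun x => Q {x}) := by
  unfold hellingerInt hH
  rw [lintegral_fintype]
  refine Finset.sum_congr rfl fun x _ => ?_
  have h1 : P ≪ P + Q := Measure.AbsolutelyContinuous.rfl.add_right Q
  have h2 : Q ≪ P + Q := by
    rw [add_comm]; exact Measure.AbsolutelyContinuous.rfl.add_right P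
  refine term_eq ha (measure_ne_top _ _) (measure_ne_top _ _) (by simp) ?_ ?_
  · have := Measure.setLIntegral_rnDeriv h1 {x}
    rwa [lintegral_singleton] at this
  · have := Measure.setLIntegral_rnDeriv h2 {x}
    rwa [lintegral_singleton] at this

lemma toENN_mono : Monotone EReal.toENNReal := fun _ _ h => EReal.toENNReal_le_toENNReal h

lemma div_eq_gG {X : Type*} [Fintype X] [MeasurableSpace X] [MeasurableSingletonClass X]
    (P Q : Measure X) [IsProbabilityMeasure P] [IsProbabilityMeasure Q] (α : ℝ≥0∞) :
    erealToENNReal (renyiDiv α P Q) = gG α (fun x => P {x}) (fun x => Q {x}) := by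
  have h : renyiDiv α P Q = limsup (fun a => renyiSimple a P Q) (lF α) := by
    unfold renyiDiv lF
    split_ifs
    · rfl
    · rfl
    · rfl
    · exact ((limsup_congr (by simp)).trans
        (limsup_const (renyiSimple α.toReal P Q))).symm
  have h' : ∀ x, erealToENNReal x = x.toENNReal := fun x => rfl
  rw [h, h', toENN_mono.map_limsup_of_continuousAt _ EReal.continuous_toENNReal.continuousAt]
  unfold gG
  refine limsup_congr ?_
  filter_upwards [lF_ev α] with a ha
  simp only [Function.comp, sS, renyiSimple]
  rw [hell_eq P Q ha.1]

lemma mul_neg_le {c : ℝ} (hc : c ≤ 0) {x y : EReal} (h : x ≤ y) : (c : EReal) * y ≤ c * x := by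
  rw [mul_comm, mul_comm (c : EReal)]
  exact EReal.mul_le_mul_of_nonpos_right h (by exact_mod_cast hc)

lemma mul_pos_le {c : ℝ} (hc : 0 ≤ c) {x y : EReal} (h : x ≤ y) : (c : EReal) * x ≤ c * y :=
  mul_le_mul_of_nonneg_left h (by exact_mod_cast hc)

/-- uniform bound -/
lemma sS_bound {X : Type*} [Fintype X] {a : ℝ} (ha : 0 < a) (ha1 : a ≠ 1) {p q : X → ℝ≥0∞}
    (hp : ∑ x, p x = 1) {δ : ℝ≥0∞} (hq : ∀ x, δ ≤ q x) :
    sS a p q ≤ (-ENNReal.log δ).toENNReal := by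
  have hp1 : ∀ x, p x ≤ 1 := fun x => by
    rw [← hp]; exact Finset.single_le_sum (fun _ _ => zero_le) (Finset.mem_univ x)
  unfold sS
  refine toENN_mono ?_
  have e : -ENNReal.log δ = (((a - 1)⁻¹ : ℝ) : EReal) * ENNReal.log (δ ^ (1 - a)) := by
    rw [ENNReal.log_rpow, ← mul_assoc, ← EReal.coe_mul]
    have : (a - 1)⁻¹ * (1 - a) = -1 := by
      have := sub_ne_zero.2 ha1
      field_simp; ring
    rw [this]; simp
  rw [e]
  rcases lt_or_gt_of_ne ha1 with h | h
  · refine mul_neg_le (inv_nonpos.2 (by linarith)) (ENNReal.log_monotone ?_)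
    calc δ ^ (1 - a) = ∑ x, p x * δ ^ (1 - a) := by rw [← Finset.sum_mul, hp, one_mul]
      _ ≤ _ := by
        refine Finset.sum_le_sum fun x _ => ?_
        gcongr
        · calc p x = p x ^ (1:ℝ) := by simp
            _ ≤ _ := ENNReal.rpow_le_rpow_of_exponent_ge (hp1 x) h.le
        · exact hq x
  · refine mul_pos_le (inv_nonneg.2 (by linarith)) (ENNReal.log_monotone ?_)
    calc _ ≤ ∑ x, p x * δ ^ (1 - a) := by
          refine Finset.sum_le_sum fun x _ => ?_
          refine mul_le_mul' ?_ ?_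
          · exact ENNReal.rpow_le_self_of_le_one (hp1 x) h.le
          · rw [show 1 - a = -(a - 1) by ring, ENNReal.rpow_neg, ENNReal.rpow_neg]
            rw [ENNReal.inv_le_inv]
            exact ENNReal.rpow_le_rpow (hq x) (by linarith)
      _ = _ := by rw [← Finset.sum_mul, hp, one_mul]

lemma gG_ne_top {X : Type*} [Fintype X] (α : ℝ≥0∞) {p q : X → ℝ≥0∞}
    (hp : ∑ x, p x = 1) {δ : ℝ≥0∞} (hδ : δ ≠ 0) (hq : ∀ x, δ ≤ q x) :
    gG α p q ≠ ⊤ := by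
  have h : gG α p q ≤ (-ENNReal.log δ).toENNReal := by
    unfold gG
    refine limsup_le_of_le (by isBoundedDefault) ?_
    filter_upwards [lF_ev α] with a ha using sS_bound ha.1 ha.2 hp hq
  refine ne_top_of_le_ne_top ?_ h
  rw [EReal.toENNReal_ne_top_iff]
  simpa using hδ

lemma sS_cont {X : Type*} [Fintype X] {a : ℝ} (ha : 0 < a) (ha1 : a ≠ 1) {p : X → ℝ≥0∞}
    (hp : ∀ x, p x ≠ ⊤) : Continuous (fun q : X → ℝ≥0∞ => sS a p q) := by
  unfold sS
  refine EReal.continuous_toENNReal.comp ?_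
  have h1 : Continuous (fun q : X → ℝ≥0∞ => ENNReal.log (hH a p q)) := by
    refine ENNReal.continuous_log.comp ?_
    unfold hH
    refine continuous_finsetSum _ fun x _ => ?_
    exact (ENNReal.continuous_const_mul (ENNReal.rpow_ne_top_of_nonneg ha.le (hp x))).comp
      (ENNReal.continuous_rpow_const.comp (continuous_apply x))
  have hne : (a - 1)⁻¹ ≠ 0 := inv_ne_zero (sub_ne_zero.2 ha1)
  refine continuous_iff_continuousAt.2 fun q => ?_
  exact EReal.Tendsto.mul tendsto_const_nhds h1.continuousAt
    (Or.inl (by exact_mod_cast hne)) (Or.inl (by exact_mod_cast hne)) (Or.inl (EReal.coe_ne_bot _))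
    (Or.inl (EReal.coe_ne_top _))

lemma jterm {p q : ℝ≥0∞} (hp : p ≠ ⊤) {a : ℝ} (ha : 0 < a) (ha1 : a < 1) :
    p * (q / p) ^ (1 - a) = p ^ a * q ^ (1 - a) := by
  rcases eq_or_ne p 0 with rfl | h
  · rw [ENNReal.zero_rpow_of_pos ha, zero_mul, zero_mul]
  · rw [ENNReal.div_rpow_of_nonneg _ _ (by linarith), div_eq_mul_inv, ← ENNReal.rpow_neg,
      mul_comm (q ^ _), ← mul_assoc]
    congr 1
    nth_rewrite 1 [← ENNReal.rpow_one p]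
    rw [← ENNReal.rpow_add _ _ h hp]; ring_nf

lemma jterm' {p q : ℝ≥0∞} (hp : p ≠ ⊤) {a : ℝ} (ha1 : 1 < a) :
    p * (p / q) ^ (a - 1) = p ^ a * q ^ (1 - a) := by
  rcases eq_or_ne p 0 with rfl | h
  · rw [ENNReal.zero_rpow_of_pos (by linarith), zero_mul, zero_mul]
  · rw [ENNReal.div_rpow_of_nonneg _ _ (by linarith), div_eq_mul_inv, ← ENNReal.rpow_neg,
      ← mul_assoc, neg_sub]
    congr 1
    nth_rewrite 1 [← ENNReal.rpow_one p]
    rw [← ENNReal.rpow_add _ _ h hp]; ring_nf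

lemma sS_mono_lt {X : Type*} [Fintype X] {p q : X → ℝ≥0∞} (hp : ∑ x, p x = 1)
    (hpt : ∀ x, p x ≠ ⊤) {a b : ℝ} (ha : 0 < a) (hab : a ≤ b) (hb : b < 1) :
    sS a p q ≤ sS b p q := by
  have ha1 : a < 1 := by linarith
  have hr : 1 ≤ (1 - a) / (1 - b) := by rw [one_le_div (by linarith)]; linarith
  have h := ENNReal.rpow_arith_mean_le_arith_mean_rpow Finset.univ p
    (fun x => (q x / p x) ^ (1 - b)) hp hr
  have e1 : ∀ x, ((q x / p x) ^ (1 - b)) ^ ((1 - a) / (1 - b)) = (q x / p x) ^ (1 - a) := by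
    intro x
    rw [← ENNReal.rpow_mul]; congr 1
    have : (1 - b) ≠ 0 := by linarith
    field_simp
  simp only [e1, jterm (hpt _) ha ha1, jterm (hpt _) (ha.trans_le hab) hb] at h
  have h2 := ENNReal.log_monotone h
  rw [ENNReal.log_rpow] at h2
  have h3 := mul_neg_le (c := (a - 1)⁻¹) (inv_nonpos.2 (by linarith)) h2
  rw [← mul_assoc, ← EReal.coe_mul] at h3
  have e : (a - 1)⁻¹ * ((1 - a) / (1 - b)) = (b - 1)⁻¹ := by
    have : (1 - b) ≠ 0 := by linarith
    have : (a - 1) ≠ 0 := by linarith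
    have : (b - 1) ≠ 0 := by linarith
    field_simp; ring
  rw [e] at h3
  exact toENN_mono h3

lemma sS_mono_gt {X : Type*} [Fintype X] {p q : X → ℝ≥0∞} (hp : ∑ x, p x = 1)
    (hpt : ∀ x, p x ≠ ⊤) {a b : ℝ} (ha : 1 < a) (hab : a ≤ b) :
    sS a p q ≤ sS b p q := by
  have hb1 : 1 < b := by linarith
  have hr : 1 ≤ (b - 1) / (a - 1) := by rw [one_le_div (by linarith)]; linarith
  have h := ENNReal.rpow_arith_mean_le_arith_mean_rpow Finset.univ p
    (fun x => (p x / q x) ^ (a - 1)) hp hr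
  have e1 : ∀ x, ((p x / q x) ^ (a - 1)) ^ ((b - 1) / (a - 1)) = (p x / q x) ^ (b - 1) := by
    intro x
    rw [← ENNReal.rpow_mul]; congr 1
    have : (a - 1) ≠ 0 := by linarith
    field_simp
  simp only [e1, jterm' (hpt _) ha, jterm' (hpt _) hb1] at h
  have h2 := ENNReal.log_monotone h
  rw [ENNReal.log_rpow] at h2
  have h3 := mul_pos_le (c := (b - 1)⁻¹) (inv_nonneg.2 (by linarith)) h2
  rw [← mul_assoc, ← EReal.coe_mul] at h3
  have e : (b - 1)⁻¹ * ((b - 1) / (a - 1)) = (a - 1)⁻¹ := by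
    have : (a - 1) ≠ 0 := by linarith
    have : (b - 1) ≠ 0 := by linarith
    field_simp
  rw [e] at h3
  exact toENN_mono h3

lemma amgm {s t : ℝ} (hs : 0 < s) (ht : 0 < t) (hst : s + t = 1) (x y : ℝ≥0∞) :
    x ^ s * y ^ t ≤ ENNReal.ofReal s * x + ENNReal.ofReal t * y := by
  rcases eq_or_ne x ⊤ with rfl | hx
  · rw [ENNReal.mul_top (by simpa using hs)]; simp
  rcases eq_or_ne y ⊤ with rfl | hy
  · rw [ENNReal.mul_top (by simpa using ht)]; simp
  lift x to ℝ≥0 using hx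
  lift y to ℝ≥0 using hy
  lift s to ℝ≥0 using hs.le
  lift t to ℝ≥0 using ht.le
  rw [← ENNReal.coe_rpow_of_nonneg _ hs.le, ← ENNReal.coe_rpow_of_nonneg _ ht.le,
    ENNReal.ofReal_coe_nnreal, ENNReal.ofReal_coe_nnreal]
  exact_mod_cast NNReal.geom_mean_le_arith_mean2_weighted s t x y (by exact_mod_cast hst)

lemma conc {s t r : ℝ} (hs : 0 < s) (ht : 0 < t) (hst : s + t = 1) (hr : 0 < r) (hr1 : r < 1)
    (x y : ℝ≥0∞) :
    ENNReal.ofReal s * x ^ r + ENNReal.ofReal t * y ^ r ≤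
      (ENNReal.ofReal s * x + ENNReal.ofReal t * y) ^ r := by
  have h := ENNReal.rpow_arith_mean_le_arith_mean2_rpow (ENNReal.ofReal s) (ENNReal.ofReal t)
    (x ^ r) (y ^ r) (by rw [← ENNReal.ofReal_add hs.le ht.le, hst, ENNReal.ofReal_one])
    (p := r⁻¹) ((one_le_inv₀ hr).2 hr1.le)
  rw [ENNReal.rpow_rpow_inv hr.ne', ENNReal.rpow_rpow_inv hr.ne'] at h
  exact (ENNReal.rpow_inv_le_iff hr).1 h

lemma ereal_lin {c s t : ℝ} (hs : 0 < s) (ht : 0 < t) {A B : EReal}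
    (h : 0 ≤ c ∨ (A ≠ ⊤ ∧ B ≠ ⊤)) :
    ((c : EReal) * (s * A + t * B)).toENNReal ≤
      ENNReal.ofReal s * ((c : EReal) * A).toENNReal +
        ENNReal.ofReal t * ((c : EReal) * B).toENNReal := by
  have key : (c : EReal) * (s * A + t * B) = s * (c * A) + t * (c * B) := by
    rcases le_or_gt 0 c with hc | hc
    · rw [EReal.left_distrib_of_nonneg_of_ne_top (by exact_mod_cast hc) (EReal.coe_ne_top _)]
      rw [mul_left_comm, mul_left_comm (c : EReal)]
    · obtain ⟨hA, hB⟩ := h.resolve_left (not_le.2 hc)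
      have hc' : (c : EReal) = -((-c : ℝ) : EReal) := by simp
      have hsA : (s : EReal) * A ≠ ⊤ := by
        induction A using EReal.rec with
        | bot => rw [EReal.coe_mul_bot_of_pos hs]; exact bot_ne_top
        | top => exact absurd rfl hA
        | coe a => rw [← EReal.coe_mul]; exact EReal.coe_ne_top _
      have htB : (t : EReal) * B ≠ ⊤ := by
        induction B using EReal.rec with
        | bot => rw [EReal.coe_mul_bot_of_pos ht]; exact bot_ne_top
        | top => exact absurd rfl hB
        | coe a => rw [← EReal.coe_mul]; exact EReal.coe_ne_top _
      have hk : ∀ Z : EReal, Z ≠ ⊤ → ((-c : ℝ) : EReal) * Z ≠ ⊤ := by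
        intro Z hZ
        induction Z using EReal.rec with
        | bot => rw [EReal.coe_mul_bot_of_pos (by linarith)]; exact bot_ne_top
        | top => exact absurd rfl hZ
        | coe a => rw [← EReal.coe_mul]; exact EReal.coe_ne_top _
      rw [hc', EReal.neg_mul, EReal.left_distrib_of_nonneg_of_ne_top
        (by exact_mod_cast (by linarith : 0 ≤ -c)) (EReal.coe_ne_top _),
        EReal.neg_add (Or.inr (hk _ htB)) (Or.inl (hk _ hsA)), sub_eq_add_neg,
        EReal.neg_mul, EReal.neg_mul, mul_left_comm, mul_left_comm _ (t : EReal), mul_neg, mul_neg]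
  rw [key]
  refine EReal.toENNReal_add_le.trans ?_
  rw [EReal.toENNReal_mul (x := (s : EReal)) (by exact_mod_cast hs.le),
    EReal.toENNReal_mul (x := (t : EReal)) (by exact_mod_cast ht.le)]
  rfl

lemma sS_convex {X : Type*} [Fintype X] {a : ℝ} (ha : 0 < a) (ha1 : a ≠ 1) {p q q' : X → ℝ≥0∞}
    (hp : ∀ x, p x ≠ ⊤) (hq : ∀ x, q x ≠ ⊤) (hq' : ∀ x, q' x ≠ ⊤)
    {s t : ℝ} (hs : 0 < s) (ht : 0 < t) (hst : s + t = 1) :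
    sS a p (fun x => ENNReal.ofReal s * q x + ENNReal.ofReal t * q' x) ≤
      ENNReal.ofReal s * sS a p q + ENNReal.ofReal t * sS a p q' := by
  set m := fun x => ENNReal.ofReal s * q x + ENNReal.ofReal t * q' x with hm
  have hlog : ENNReal.log (hH a p q ^ s * hH a p q' ^ t) =
      s * ENNReal.log (hH a p q) + t * ENNReal.log (hH a p q') := by
    rw [ENNReal.log_mul_add, ENNReal.log_rpow, ENNReal.log_rpow]
  have hmain : ∀ (_ : (((a - 1)⁻¹ : ℝ) : EReal) * ENNReal.log (hH a p m) ≤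
      (((a - 1)⁻¹ : ℝ) : EReal) * ENNReal.log (hH a p q ^ s * hH a p q' ^ t))
      (_ : 0 ≤ (a - 1)⁻¹ ∨ (ENNReal.log (hH a p q) ≠ ⊤ ∧ ENNReal.log (hH a p q') ≠ ⊤)),
      sS a p m ≤ ENNReal.ofReal s * sS a p q + ENNReal.ofReal t * sS a p q' := by
    intro h h'
    rw [hlog] at h
    exact (toENN_mono h).trans (ereal_lin hs ht h')
  rcases lt_or_gt_of_ne ha1 with h | h
  · have hfin : ∀ q : X → ℝ≥0∞, (∀ x, q x ≠ ⊤) → ENNReal.log (hH a p q) ≠ ⊤ := by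
      intro q hq
      rw [Ne, ENNReal.log_eq_top_iff]
      exact ENNReal.sum_ne_top.2 fun x _ => ENNReal.mul_ne_top
        (ENNReal.rpow_ne_top_of_nonneg ha.le (hp x))
        (ENNReal.rpow_ne_top_of_nonneg (by linarith) (hq x))
    refine hmain (mul_neg_le (inv_nonpos.2 (by linarith)) (ENNReal.log_monotone ?_))
      (Or.inr ⟨hfin q hq, hfin q' hq'⟩)
    refine (amgm hs ht hst _ _).trans ?_
    unfold hH
    rw [Finset.mul_sum, Finset.mul_sum, ← Finset.sum_add_distrib]
    refine Finset.sum_le_sum fun x _ => ?_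
    calc _ = p x ^ a * (ENNReal.ofReal s * q x ^ (1 - a) + ENNReal.ofReal t * q' x ^ (1 - a)) := by
          ring
      _ ≤ _ := mul_le_mul' le_rfl (conc hs ht hst (by linarith) (by linarith) _ _)
  · refine hmain (mul_pos_le (inv_nonneg.2 (by linarith)) (ENNReal.log_monotone ?_))
      (Or.inl (inv_nonneg.2 (by linarith)))
    have hpt : ∀ x, p x ^ a * m x ^ (1 - a) ≤
        (p x ^ a * q x ^ (1 - a)) ^ s * (p x ^ a * q' x ^ (1 - a)) ^ t := by
      intro x
      rw [ENNReal.mul_rpow_of_nonneg _ _ hs.le, ENNReal.mul_rpow_of_nonneg _ _ ht.le]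
      have e1 : (p x ^ a) ^ s * (p x ^ a) ^ t = p x ^ a := by
        rw [← ENNReal.rpow_add_of_nonneg _ _ hs.le ht.le, hst, ENNReal.rpow_one]
      have e2 : m x ^ (1 - a) ≤ (q x ^ (1 - a)) ^ s * (q' x ^ (1 - a)) ^ t := by
        have e3 : (q x ^ (1 - a)) ^ s * (q' x ^ (1 - a)) ^ t = (q x ^ s * q' x ^ t) ^ (1 - a) := by
          rw [ENNReal.mul_rpow_of_ne_top (ENNReal.rpow_ne_top_of_nonneg hs.le (hq x))
            (ENNReal.rpow_ne_top_of_nonneg ht.le (hq' x)), ← ENNReal.rpow_mul, ← ENNReal.rpow_mul,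
            ← ENNReal.rpow_mul, ← ENNReal.rpow_mul, mul_comm s, mul_comm t]
        rw [e3, show 1 - a = -(a - 1) by ring, ENNReal.rpow_neg, ENNReal.rpow_neg,
          ENNReal.inv_le_inv]
        exact ENNReal.rpow_le_rpow (amgm hs ht hst _ _) (by linarith)
      calc _ ≤ ((p x ^ a) ^ s * (p x ^ a) ^ t) * ((q x ^ (1 - a)) ^ s * (q' x ^ (1 - a)) ^ t) := by
            rw [e1]; exact mul_le_mul' le_rfl e2
        _ = _ := by ring
    refine (Finset.sum_le_sum fun x _ => hpt x).trans ?_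
    have := ENNReal.inner_le_Lp_mul_Lq Finset.univ (fun x => (p x ^ a * q x ^ (1 - a)) ^ s)
      (fun x => (p x ^ a * q' x ^ (1 - a)) ^ t) (Real.HolderConjugate.inv_inv hs ht hst)
    simp only [ENNReal.rpow_rpow_inv hs.ne', ENNReal.rpow_rpow_inv ht.ne', one_div, inv_inv] at this
    exact this

lemma my_limsup_add_le {β : Type*} (l : Filter β) (u v : β → ℝ≥0∞) :
    limsup (fun x => u x + v x) l ≤ limsup u l + limsup v l := by
  refine ENNReal.le_of_forall_pos_le_add fun ε hε hfin => ?_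
  have hU : limsup u l ≠ ⊤ := (lt_of_le_of_lt le_self_add hfin).ne
  have hV : limsup v l ≠ ⊤ := (lt_of_le_of_lt le_add_self hfin).ne
  have he : (ε : ℝ≥0∞) / 2 ≠ 0 := by
    simpa using hε.ne'
  have h1 := eventually_lt_of_limsup_lt (ENNReal.lt_add_right hU he)
  have h2 := eventually_lt_of_limsup_lt (ENNReal.lt_add_right hV he)
  refine limsup_le_of_le (by isBoundedDefault) ?_
  filter_upwards [h1, h2] with x hx hy
  calc u x + v x ≤ (limsup u l + ε / 2) + (limsup v l + ε / 2) := add_le_add hx.le hy.le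
    _ = limsup u l + limsup v l + (ε / 2 + ε / 2) := by ring
    _ = _ := by rw [ENNReal.add_halves]

lemma gG_convex {X : Type*} [Fintype X] (α : ℝ≥0∞) {p q q' : X → ℝ≥0∞}
    (hp : ∀ x, p x ≠ ⊤) (hq : ∀ x, q x ≠ ⊤) (hq' : ∀ x, q' x ≠ ⊤)
    {s t : ℝ} (hs : 0 < s) (ht : 0 < t) (hst : s + t = 1) :
    gG α p (fun x => ENNReal.ofReal s * q x + ENNReal.ofReal t * q' x) ≤
      ENNReal.ofReal s * gG α p q + ENNReal.ofReal t * gG α p q' := by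
  unfold gG
  rw [← ENNReal.limsup_const_mul_of_ne_top ENNReal.ofReal_ne_top,
    ← ENNReal.limsup_const_mul_of_ne_top ENNReal.ofReal_ne_top]
  refine le_trans ?_ (my_limsup_add_le _ _ _)
  refine limsup_le_limsup ?_
  filter_upwards [lF_ev α] with a ha using sS_convex ha.1 ha.2 hp hq hq' hs ht hst

lemma rpow_tend {x : ℝ≥0∞} (hx : x ≠ 0) (hx' : x ≠ ⊤) (b : ℝ) :
    Tendsto (fun a : ℝ => x ^ a) (𝓝 b) (𝓝 (x ^ b)) := by
  lift x to ℝ≥0 using hx'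
  have hx0 : x ≠ 0 := by simpa using hx
  simp_rw [← ENNReal.coe_rpow_of_ne_zero hx0]
  exact (ENNReal.continuous_coe.tendsto _).comp
    (Tendsto.nnrpow tendsto_const_nhds tendsto_id (Or.inl hx0))

lemma term_tend {p q : ℝ≥0∞} (hp : p ≠ ⊤) (hq : q ≠ ⊤) :
    Tendsto (fun a : ℝ => p ^ a * q ^ (1 - a)) (𝓝[>] 0) (𝓝 (if p = 0 then 0 else q)) := by
  split_ifs with h
  · refine tendsto_const_nhds.congr' ?_
    filter_upwards [self_mem_nhdsWithin] with a ha
    rw [h, ENNReal.zero_rpow_of_pos ha, zero_mul]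
  · rcases eq_or_ne q 0 with rfl | hq0
    · refine tendsto_const_nhds.congr' ?_
      filter_upwards [Ioo_mem_nhdsGT (show (0:ℝ) < 1 by norm_num)] with a ha
      rw [ENNReal.zero_rpow_of_pos (by linarith [ha.2]), mul_zero]
    · have h1 := rpow_tend h hp 0
      have h2 : Tendsto (fun a : ℝ => q ^ (1 - a)) (𝓝 0) (𝓝 (q ^ (1 - (0:ℝ)))) :=
        (rpow_tend hq0 hq _).comp (tendsto_const_nhds.sub tendsto_id)
      have h3 := ENNReal.Tendsto.mul h1 (Or.inl (by simp)) h2 (Or.inr (by simp))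
      simp only [ENNReal.rpow_zero, one_mul, sub_zero, ENNReal.rpow_one] at h3
      exact h3.mono_left nhdsWithin_le_nhds

lemma gG_zero {X : Type*} [Fintype X] {p q : X → ℝ≥0∞}
    (hp : ∀ x, p x ≠ ⊤) (hq : ∀ x, q x ≠ ⊤) :
    gG 0 p q = (-ENNReal.log (∑ x, if p x = 0 then 0 else q x)).toENNReal := by
  unfold gG lF
  rw [if_pos rfl]
  refine Tendsto.limsup_eq ?_
  unfold sS
  refine (EReal.continuous_toENNReal.tendsto _).comp ?_
  have h1 : Tendsto (fun a => ENNReal.log (hH a p q)) (𝓝[>] 0)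
      (𝓝 (ENNReal.log (∑ x, if p x = 0 then 0 else q x))) :=
    (ENNReal.continuous_log.tendsto _).comp
      (tendsto_finsetSum _ fun x _ => term_tend (hp x) (hq x))
  have h2 : Tendsto (fun a : ℝ => (((a - 1)⁻¹ : ℝ) : EReal)) (𝓝[>] 0) (𝓝 ((-1 : ℝ) : EReal)) := by
    refine (continuous_coe_real_ereal.tendsto _).comp ?_
    have : Tendsto (fun a : ℝ => (a - 1)⁻¹) (𝓝 0) (𝓝 ((0 - 1)⁻¹)) :=
      Tendsto.inv₀ (tendsto_id.sub tendsto_const_nhds) (by norm_num)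
    norm_num at this
    exact this.mono_left nhdsWithin_le_nhds
  have h3 := EReal.Tendsto.mul h2 h1 (Or.inl (by norm_num)) (Or.inl (by norm_num))
    (Or.inl (EReal.coe_ne_bot _)) (Or.inl (EReal.coe_ne_top _))
  simpa using h3

lemma gG_one {X : Type*} [Fintype X] {p q : X → ℝ≥0∞} (hp1 : ∑ x, p x = 1)
    (hp : ∀ x, p x ≠ ⊤) : gG 1 p q = ⨆ a : Ioo (0:ℝ) 1, sS a p q := by
  unfold gG lF
  rw [if_neg one_ne_zero, if_pos rfl]
  refine Tendsto.limsup_eq ?_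
  have hm : MonotoneOn (fun a => sS a p q) (Ioo 0 1) := fun a ha b hb hab =>
    sS_mono_lt hp1 hp ha.1 hab hb.2
  have := hm.tendsto_nhdsWithin_Ioo_left ⟨1/2, by norm_num, by norm_num⟩ (OrderTop.bddAbove _)
  rwa [sSup_image'] at this

lemma gG_top {X : Type*} [Fintype X] {p q : X → ℝ≥0∞} (hp1 : ∑ x, p x = 1)
    (hp : ∀ x, p x ≠ ⊤) : gG ⊤ p q = ⨆ a : ℝ, sS (max a 2) p q := by
  unfold gG lF
  rw [if_neg ENNReal.top_ne_zero, if_neg ENNReal.top_ne_one, if_pos rfl]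
  refine Tendsto.limsup_eq ?_
  have hm : Monotone (fun a => sS (max a 2) p q) := fun a b hab =>
    sS_mono_gt hp1 hp (lt_of_lt_of_le (by norm_num) (le_max_right a 2)) (max_le_max_right 2 hab)
  refine (tendsto_atTop_iSup hm).congr' ?_
  filter_upwards [eventually_ge_atTop 2] with a ha
  rw [max_eq_left ha]

lemma gG_lsc {X : Type*} [Fintype X] (α : ℝ≥0∞) {p : X → ℝ≥0∞} (hp1 : ∑ x, p x = 1)
    (hp : ∀ x, p x ≠ ⊤) :
    LowerSemicontinuous (fun v : X → ℝ => gG α p (fun x => ENNReal.ofReal (v x))) := by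
  have hv : Continuous (fun v : X → ℝ => fun x => ENNReal.ofReal (v x)) :=
    continuous_pi fun x => ENNReal.continuous_ofReal.comp (continuous_apply x)
  have hs : ∀ a : ℝ, 0 < a → a ≠ 1 →
      LowerSemicontinuous (fun v : X → ℝ => sS a p (fun x => ENNReal.ofReal (v x))) :=
    fun a h h' => ((sS_cont h h' hp).comp hv).lowerSemicontinuous
  rcases eq_or_ne α 0 with rfl | h0
  · simp_rw [gG_zero hp (fun _ => ENNReal.ofReal_ne_top)]
    refine Continuous.lowerSemicontinuous ?_
    refine EReal.continuous_toENNReal.comp (continuous_neg.comp (ENNReal.continuous_log.comp ?_))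
    refine continuous_finsetSum _ fun x _ => ?_
    split_ifs
    · exact continuous_const
    · exact ENNReal.continuous_ofReal.comp (continuous_apply x)
  rcases eq_or_ne α 1 with rfl | h1
  · simp_rw [gG_one hp1 hp]
    exact lowerSemicontinuous_iSup fun a => hs a a.2.1 a.2.2.ne
  rcases eq_or_ne α ⊤ with rfl | h2
  · simp_rw [gG_top hp1 hp]
    refine lowerSemicontinuous_iSup fun a => hs _ ?_ ?_
    · exact lt_of_lt_of_le (by norm_num) (le_max_right a 2)
    · exact (lt_of_lt_of_le (by norm_num) (le_max_right a 2)).ne'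
  · have hev := lF_ev α
    have : ∀ q, gG α p q = sS α.toReal p q := by
      intro q
      unfold gG lF
      rw [if_neg h0, if_neg h1, if_neg h2]
      exact (limsup_congr (by simp)).trans (limsup_const (sS α.toReal p q))
    simp_rw [this]
    unfold lF at hev
    rw [if_neg h0, if_neg h1, if_neg h2, eventually_pure] at hev
    exact hs _ hev.1 hev.2

/-- **Channel capacity equals minimax redundancy.** Let `X` be a finite set (with the
discrete σ-algebra), let `Θ` be a nonempty topological space with its Borel σ-algebra in
which singletons are closed, and let `θ ↦ Pθ` be a measurable family of probability
distributions on `X`.  For every order `α ∈ [0,∞]`, the channel capacity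
`C_α = sup_π inf_Q ∫ D_α(Pθ‖Q) dπ(θ)` equals the minimax redundancy
`R_α = inf_Q sup_θ D_α(Pθ‖Q)`. -/
theorem channel_capacity_eq_minimax_redundancy
    {X Θ : Type*} [Fintype X] [MeasurableSpace X] [MeasurableSingletonClass X]
    [TopologicalSpace Θ] [MeasurableSpace Θ] [BorelSpace Θ] [T1Space Θ] [Nonempty Θ]
    (Pf : Θ → Measure X) (hPmeas : Measurable Pf)
    (hPprob : ∀ θ, IsProbabilityMeasure (Pf θ)) (α : ℝ≥0∞) :
    (⨆ (prior : Measure Θ) (_ : IsProbabilityMeasure prior),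
      ⨅ (Q : Measure X) (_ : IsProbabilityMeasure Q),
        ∫⁻ θ, erealToENNReal (renyiDiv α (Pf θ) Q) ∂prior)
    = ⨅ (Q : Measure X) (_ : IsProbabilityMeasure Q),
        ⨆ θ : Θ, erealToENNReal (renyiDiv α (Pf θ) Q) := by
  apply le_antisymm
  · refine iSup₂_le fun prior hprior => le_iInf₂ fun Q hQ => iInf₂_le_of_le Q hQ ?_
    calc _ ≤ ∫⁻ _, (⨆ θ : Θ, erealToENNReal (renyiDiv α (Pf θ) Q)) ∂prior :=
          lintegral_mono fun θ => le_iSup (fun θ => erealToENNReal (renyiDiv α (Pf θ) Q)) θ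
      _ = _ := by simp
  refine le_of_forall_lt fun c hc => ?_
  obtain ⟨c', hcc', hc⟩ := exists_between hc
  refine hcc'.trans_le ?_
  let f : Θ → (X → ℝ) → ℝ≥0∞ := fun θ v => gG α (fun x => Pf θ {x}) (fun x => ENNReal.ofReal (v x))
  have hp1 : ∀ θ, ∑ x, Pf θ {x} = 1 := fun θ => by
    have := hPprob θ
    have h := sum_measure_singleton (μ := Pf θ) (s := Finset.univ)
    rw [h]; simp
  have hpt : ∀ θ x, Pf θ {x} ≠ ⊤ := fun θ x => by
    have := hPprob θ
    exact measure_ne_top _ _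
  have hX : Nonempty X := by
    obtain ⟨θ⟩ := ‹Nonempty Θ›
    by_contra h
    rw [not_nonempty_iff] at h
    have := hp1 θ
    simp at this
  have hcard : (0:ℝ) < Fintype.card X := by exact_mod_cast Fintype.card_pos
  let q0 : X → ℝ := fun _ => (Fintype.card X : ℝ)⁻¹
  have hq0 : q0 ∈ stdSimplex ℝ X := ⟨fun _ => inv_nonneg.2 hcard.le, by
    simp [q0]⟩
  obtain ⟨F, w, hw, hF⟩ := mm_main (stdSimplex ℝ X) (isCompact_stdSimplex ℝ X) (convex_stdSimplex ℝ X) f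
    (fun θ => gG_lsc α (hp1 θ) (hpt θ))
    (fun θ x hx y hy s t hs ht hst => by
      have := gG_convex α (hpt θ) (q := fun z => ENNReal.ofReal (x z))
        (q' := fun z => ENNReal.ofReal (y z)) (fun _ => ENNReal.ofReal_ne_top)
        (fun _ => ENNReal.ofReal_ne_top) hs ht hst
      refine le_trans (le_of_eq ?_) this
      simp only [f]
      congr 1
      ext z
      simp only [Pi.add_apply, Pi.smul_apply, smul_eq_mul]
      rw [ENNReal.ofReal_add (mul_nonneg hs.le (hx.1 z)) (mul_nonneg ht.le (hy.1 z)),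
        ENNReal.ofReal_mul hs.le, ENNReal.ofReal_mul ht.le])
    q0 hq0
    (fun θ => gG_ne_top α (hp1 θ) (δ := ENNReal.ofReal ((Fintype.card X : ℝ)⁻¹))
      (by simpa using hcard) (fun x => le_rfl))
    (fun θ q hq s t hs ht hst =>
      gG_ne_top α (hp1 θ) (δ := ENNReal.ofReal (t * (Fintype.card X : ℝ)⁻¹))
        (by
          rw [Ne, ENNReal.ofReal_eq_zero, not_le]
          exact mul_pos ht (inv_pos.2 hcard))
        (fun x => ENNReal.ofReal_le_ofReal (by
          simp only [Pi.add_apply, Pi.smul_apply, smul_eq_mul, q0]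
          have := mul_nonneg hs.le (hq.1 x)
          linarith)))
    c' (fun v hv => by
      let Q : Measure X := Measure.sum (fun x => ENNReal.ofReal (v x) • Measure.dirac x)
      have hQx : ∀ x, Q {x} = ENNReal.ofReal (v x) := fun x => Measure.sum_smul_dirac_singleton
      have hQ : IsProbabilityMeasure Q := by
        constructor
        have h := sum_measure_singleton (μ := Q) (s := Finset.univ)
        rw [Finset.coe_univ] at h
        rw [← h]
        simp_rw [hQx]
        rw [← ENNReal.ofReal_sum_of_nonneg (fun i _ => hv.1 i), hv.2, ENNReal.ofReal_one]
      have h := hc.trans_le (iInf₂_le Q hQ)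
      obtain ⟨θ, hθ⟩ := lt_iSup_iff.1 h
      refine ⟨θ, ?_⟩
      have := hPprob θ
      rw [div_eq_gG] at hθ
      simpa only [hQx] using hθ)
  let prior : Measure Θ := ∑ i : F, w i • Measure.dirac (i : Θ)
  have hprior : IsProbabilityMeasure prior := by
    constructor
    simpa [prior] using hw
  refine le_iSup₂_of_le prior hprior (le_iInf₂ fun Q hQ => ?_)
  have hv : (fun x => (Q {x}).toReal) ∈ stdSimplex ℝ X := by
    refine ⟨fun x => ENNReal.toReal_nonneg, ?_⟩
    rw [← ENNReal.toReal_sum (fun x _ => measure_ne_top _ _)]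
    have h := sum_measure_singleton (μ := Q) (s := Finset.univ)
    rw [h]; simp
  refine (hF _ hv).trans (le_of_eq ?_)
  simp only [prior]
  rw [lintegral_finsetSum_measure]
  refine Finset.sum_congr rfl fun i _ => ?_
  rw [lintegral_smul_measure, lintegral_dirac, smul_eq_mul]
  have := hPprob i
  rw [div_eq_gG]
  simp only [f]
  congr 2
  ext x
  exact ENNReal.ofReal_toReal (measure_ne_top _ _)
end

section
/- (Increasing limits of σ-algebras.) Let P, Q be probability measures on a measurable space (X, 𝓐), let 𝓐₁ ⊆ 𝓐₂ ⊆ ⋯ ⊆ 𝓐 be an increasing family of sub-σ-algebras, and let 𝓐_∞ = σ(⋃_{n=1}^∞ 𝓐_n) be the smallest σ-algebra containing all of them. Then for any order α ∈ (0,∞], lim_{n→∞} D_α(P|𝓐_n ‖ Q|𝓐_n) = D_α(P|𝓐_∞ ‖ Q|𝓐_∞). -/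
open MeasureTheory Real Filter Set
open scoped ENNReal NNReal Topology Classical

lemma amgm_lt {a : ℝ} (h0 : 0 < a) (h1 : a < 1) (p q t : ℝ≥0∞) (hp : p ≠ ∞) (hq : q ≠ ∞) :
    p ^ a * q ^ (1 - a) ≤ ENNReal.ofReal a * (p * t ^ (a - 1))
      + ENNReal.ofReal (1 - a) * (q * t ^ a) := by
  have h1' : 0 < 1 - a := by linarith
  by_cases hp0 : p = 0
  · simp [hp0, h0]
  by_cases hq0 : q = 0
  · simp [hq0, h1']
  by_cases ht0 : t = 0
  · rw [ht0, ENNReal.zero_rpow_of_neg (by linarith : a - 1 < 0), ENNReal.mul_top hp0,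
      ENNReal.mul_top (by simpa using h0)]
    simp
  by_cases htt : t = ∞
  · rw [htt, ENNReal.top_rpow_of_pos h0, ENNReal.mul_top hq0,
      ENNReal.mul_top (by simpa using h1')]
    simp
  lift p to ℝ≥0 using hp
  lift q to ℝ≥0 using hq
  lift t to ℝ≥0 using htt
  have hp0' : p ≠ 0 := by exact_mod_cast hp0
  have hq0' : q ≠ 0 := by exact_mod_cast hq0
  have ht0' : t ≠ 0 := by exact_mod_cast ht0
  have key := NNReal.geom_mean_le_arith_mean2_weighted a.toNNReal (1 - a).toNNReal
    (p * t ^ (a - 1)) (q * t ^ a) (by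
      rw [← Real.toNNReal_add h0.le h1'.le]; simp)
  rw [Real.coe_toNNReal _ h0.le, Real.coe_toNNReal _ h1'.le, NNReal.mul_rpow, NNReal.mul_rpow,
    ← NNReal.rpow_mul, ← NNReal.rpow_mul] at key
  have e : p ^ a * t ^ ((a - 1) * a) * (q ^ (1 - a) * t ^ (a * (1 - a))) = p ^ a * q ^ (1 - a) := by
    have : t ^ ((a - 1) * a) * t ^ (a * (1 - a)) = 1 := by
      rw [← NNReal.rpow_add ht0']
      ring_nf; simp
    calc _ = p ^ a * q ^ (1 - a) * (t ^ ((a - 1) * a) * t ^ (a * (1 - a))) := by ring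
      _ = _ := by rw [this, mul_one]
  rw [e] at key
  rw [← ENNReal.coe_rpow_of_ne_zero hp0', ← ENNReal.coe_rpow_of_ne_zero hq0',
    ← ENNReal.coe_rpow_of_ne_zero ht0', ← ENNReal.coe_rpow_of_ne_zero ht0']
  unfold ENNReal.ofReal
  exact_mod_cast key

lemma amgm_gt {a : ℝ} (h1 : 1 < a) (p q t : ℝ≥0∞) (hp : p ≠ ∞) (hq : q ≠ ∞) (ht : t ≠ ∞) :
    ENNReal.ofReal a * (p * t ^ (a - 1)) ≤ p ^ a * q ^ (1 - a)
      + ENNReal.ofReal (a - 1) * (q * t ^ a) := by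
  have h1' : 0 < a - 1 := by linarith
  have h0 : 0 < a := by linarith
  by_cases hp0 : p = 0
  · simp [hp0]
  by_cases hq0 : q = 0
  · rw [hq0, ENNReal.zero_rpow_of_neg (by linarith : 1 - a < 0), ENNReal.mul_top]
    · simp
    · simp [hp0, hp]
  by_cases ht0 : t = 0
  · simp [ht0, h1']
  lift p to ℝ≥0 using hp
  lift q to ℝ≥0 using hq
  lift t to ℝ≥0 using ht
  have hp0' : p ≠ 0 := by exact_mod_cast hp0
  have hq0' : q ≠ 0 := by exact_mod_cast hq0
  have ht0' : t ≠ 0 := by exact_mod_cast ht0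
  have key := NNReal.geom_mean_le_arith_mean2_weighted (1/a).toNNReal (1 - 1/a).toNNReal
    (p ^ a * q ^ (1 - a)) (q * t ^ a) (by
      rw [← Real.toNNReal_add (by positivity) (by rw [sub_nonneg, div_le_one h0]; exact h1.le)]; simp)
  rw [Real.coe_toNNReal _ (by positivity), Real.coe_toNNReal _
    (by rw [sub_nonneg, div_le_one h0]; exact h1.le), NNReal.mul_rpow, NNReal.mul_rpow,
    ← NNReal.rpow_mul, ← NNReal.rpow_mul, ← NNReal.rpow_mul] at key
  have e : p ^ (a * (1/a)) * q ^ ((1 - a) * (1/a)) * (q ^ (1 - 1/a) * t ^ (a * (1 - 1/a)))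
      = p * t ^ (a - 1) := by
    have : q ^ ((1 - a) * (1/a)) * q ^ (1 - 1/a) = 1 := by
      rw [← NNReal.rpow_add hq0', show (1 - a) * (1/a) + (1 - 1/a) = 0 by field_simp; ring]
      simp
    calc _ = p ^ (a * (1/a)) * t ^ (a * (1 - 1/a)) * (q ^ ((1 - a) * (1/a)) * q ^ (1 - 1/a)) := by
            ring
      _ = _ := by
        rw [this, mul_one, show a * (1/a) = 1 by field_simp, show a * (1 - 1/a) = a - 1 by field_simp]
        simp
  rw [e] at key
  have key2 : a.toNNReal * (p * t ^ (a - 1)) ≤ p ^ a * q ^ (1 - a)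
      + (a - 1).toNNReal * (q * t ^ a) := by
    calc _ ≤ a.toNNReal * _ := mul_le_mul_right key _
      _ = _ := by
        rw [mul_add, ← mul_assoc, ← mul_assoc (a.toNNReal) ((1 - 1/a).toNNReal), ← Real.toNNReal_mul h0.le, ← Real.toNNReal_mul h0.le,
          show a * (1/a) = 1 by field_simp, show a * (1 - 1/a) = a - 1 by field_simp]
        simp
  rw [← ENNReal.coe_rpow_of_ne_zero hp0', ← ENNReal.coe_rpow_of_ne_zero hq0',
    ← ENNReal.coe_rpow_of_ne_zero ht0', ← ENNReal.coe_rpow_of_ne_zero ht0']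
  unfold ENNReal.ofReal
  exact_mod_cast key2

lemma ac_left {X : Type*} {mX : MeasurableSpace X} (P Q : Measure X) : P ≪ P + Q :=
  Measure.absolutelyContinuous_of_le (Measure.le_add_right le_rfl)

lemma ac_right {X : Type*} {mX : MeasurableSpace X} (P Q : Measure X) : Q ≪ P + Q :=
  Measure.absolutelyContinuous_of_le (Measure.le_add_left le_rfl)

lemma lint_trim {X : Type*} {m mX : MeasurableSpace X} (hm : m ≤ mX) (P ν : Measure X)
    [IsFiniteMeasure P] [IsFiniteMeasure ν] (h : P ≪ ν)
    (g : X → ℝ≥0∞) (hg : Measurable[m] g) :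
    ∫⁻ x, P.rnDeriv ν x * g x ∂ν
      = ∫⁻ x, (P.trim hm).rnDeriv (ν.trim hm) x * g x ∂(ν.trim hm) := by
  rw [lintegral_rnDeriv_mul h (hg.mono hm le_rfl).aemeasurable,
    lintegral_rnDeriv_mul (h.trim hm) hg.aemeasurable, lintegral_trim hm hg]

lemma ae_props {X : Type*} {mX : MeasurableSpace X} (P Q : Measure X)
    [IsFiniteMeasure P] [IsFiniteMeasure Q] :
    ∀ᵐ x ∂(P + Q), P.rnDeriv (P + Q) x ≤ 1 ∧ Q.rnDeriv (P + Q) x ≤ 1 ∧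
      P.rnDeriv (P + Q) x + Q.rnDeriv (P + Q) x = 1 := by
  filter_upwards [Measure.rnDeriv_add' P Q (P + Q), Measure.rnDeriv_self (P + Q)] with x h1 h2
  rw [h1, Pi.add_apply] at h2
  exact ⟨h2 ▸ le_self_add, h2 ▸ le_add_self, h2⟩

lemma dp_lt {X : Type*} {m mX : MeasurableSpace X} (hm : m ≤ mX) (P Q : Measure X)
    [IsFiniteMeasure P] [IsFiniteMeasure Q] {a : ℝ} (h0 : 0 < a) (h1 : a < 1) :
    hellingerInt a P Q ≤ @hellingerInt X m a (P.trim hm) (Q.trim hm) := by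
  unfold hellingerInt
  rw [← trim_add hm]
  set ν := P + Q with hν
  set p := @Measure.rnDeriv X m (P.trim hm) (ν.trim hm)
  set q := @Measure.rnDeriv X m (Q.trim hm) (ν.trim hm)
  have hp : Measurable[m] p := Measure.measurable_rnDeriv _ _
  have hq : Measurable[m] q := Measure.measurable_rnDeriv _ _
  have hprops : ∀ᵐ x ∂(ν.trim hm), p x ≤ 1 ∧ q x ≤ 1 ∧ p x + q x = 1 := by
    have := ae_props (P.trim hm) (Q.trim hm)
    rw [← trim_add hm] at this
    exact this
  have ht : Measurable[m] (fun x => p x / q x) := Measurable.div hp hq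
  have ht1 : Measurable[m] (fun x => (p x / q x) ^ (a - 1)) := ht.pow_const _
  have ht2 : Measurable[m] (fun x => (p x / q x) ^ a) := ht.pow_const _
  calc ∫⁻ x, P.rnDeriv ν x ^ a * Q.rnDeriv ν x ^ (1 - a) ∂ν
      ≤ ∫⁻ x, ENNReal.ofReal a * (P.rnDeriv ν x * (p x / q x) ^ (a - 1))
          + ENNReal.ofReal (1 - a) * (Q.rnDeriv ν x * (p x / q x) ^ a) ∂ν := by
        apply lintegral_mono_ae
        filter_upwards [ae_props P Q] with x hx
        exact amgm_lt h0 h1 _ _ _ (ne_top_of_le_ne_top (by simp) hx.1)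
          (ne_top_of_le_ne_top (by simp) hx.2.1)
    _ = ENNReal.ofReal a * (∫⁻ x, P.rnDeriv ν x * (p x / q x) ^ (a - 1) ∂ν)
          + ENNReal.ofReal (1 - a) * ∫⁻ x, Q.rnDeriv ν x * (p x / q x) ^ a ∂ν := by
        have m1 : Measurable (fun x => P.rnDeriv ν x * (p x / q x) ^ (a - 1)) :=
          (Measure.measurable_rnDeriv P ν).mul (ht1.mono hm le_rfl)
        have m2 : Measurable (fun x => Q.rnDeriv ν x * (p x / q x) ^ a) :=
          (Measure.measurable_rnDeriv Q ν).mul (ht2.mono hm le_rfl)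
        rw [lintegral_add_left (m1.const_mul _), lintegral_const_mul _ m1, lintegral_const_mul _ m2]
    _ = ENNReal.ofReal a * (∫⁻ x, p x * (p x / q x) ^ (a - 1) ∂(ν.trim hm))
          + ENNReal.ofReal (1 - a) * ∫⁻ x, q x * (p x / q x) ^ a ∂(ν.trim hm) := by
        rw [lint_trim hm P ν (ac_left P Q) _ ht1, lint_trim hm Q ν (ac_right P Q) _ ht2]
    _ ≤ ENNReal.ofReal a * (∫⁻ x, p x ^ a * q x ^ (1 - a) ∂(ν.trim hm))
          + ENNReal.ofReal (1 - a) * ∫⁻ x, p x ^ a * q x ^ (1 - a) ∂(ν.trim hm) := by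
        gcongr ENNReal.ofReal a * ?_ + ENNReal.ofReal (1 - a) * ?_
        · apply lintegral_mono_ae
          filter_upwards [hprops] with x hx
          by_cases hp0 : p x = 0
          · simp [hp0]
          have hpt : p x ≠ ∞ := ne_top_of_le_ne_top (by simp) hx.1
          have hqt : q x ≠ ∞ := ne_top_of_le_ne_top (by simp) hx.2.1
          by_cases hq0 : q x = 0
          · rw [hq0, ENNReal.div_zero hp0, ENNReal.top_rpow_of_neg (by linarith)]; simp
          apply le_of_eq
          rw [div_eq_mul_inv, ENNReal.mul_rpow_of_ne_top hpt (by simpa using hq0), ← mul_assoc,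
            ENNReal.inv_rpow, ← ENNReal.rpow_neg]
          nth_rewrite 1 [← ENNReal.rpow_one (p x)]
          rw [← ENNReal.rpow_add _ _ hp0 hpt]
          congr 2 <;> ring
        · apply lintegral_mono_ae
          filter_upwards [hprops] with x hx
          have hpt : p x ≠ ∞ := ne_top_of_le_ne_top (by simp) hx.1
          have hqt : q x ≠ ∞ := ne_top_of_le_ne_top (by simp) hx.2.1
          by_cases hq0 : q x = 0
          · simp [hq0]
          apply le_of_eq
          rw [div_eq_mul_inv, ENNReal.mul_rpow_of_nonneg _ _ h0.le, mul_left_comm,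
            ENNReal.inv_rpow, ← ENNReal.rpow_neg]
          nth_rewrite 1 [← ENNReal.rpow_one (q x)]
          rw [← ENNReal.rpow_add _ _ hq0 hqt]
          congr 2
    _ = _ := by
        rw [← add_mul, ← ENNReal.ofReal_add h0.le (by linarith)]
        simp

lemma dp_gt_aux {X : Type*} {m mX : MeasurableSpace X} (hm : m ≤ mX) (P Q : Measure X)
    [IsFiniteMeasure P] [IsFiniteMeasure Q] {a : ℝ} (h1 : 1 < a) (t : X → ℝ≥0∞)
    (ht : Measurable[m] t) (M : ℝ≥0∞) (hM : M ≠ ∞) (htM : ∀ x, t x ≤ M)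
    (htq : ∀ x, (Q.trim hm).rnDeriv ((P + Q).trim hm) x * t x
      ≤ (P.trim hm).rnDeriv ((P + Q).trim hm) x) :
    ∫⁻ x, (P.trim hm).rnDeriv ((P + Q).trim hm) x * t x ^ (a - 1) ∂((P + Q).trim hm)
      ≤ hellingerInt a P Q := by
  unfold hellingerInt
  set ν := P + Q with hν
  set p := @Measure.rnDeriv X m (P.trim hm) (ν.trim hm)
  set q := @Measure.rnDeriv X m (Q.trim hm) (ν.trim hm)
  have ha : 0 < a - 1 := by linarith
  have ht1 : Measurable[m] (fun x => t x ^ (a - 1)) := ht.pow_const _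
  have ht2 : Measurable[m] (fun x => t x ^ a) := ht.pow_const _
  set A := ∫⁻ x, p x * t x ^ (a - 1) ∂(ν.trim hm) with hA
  set B := ∫⁻ x, q x * t x ^ a ∂(ν.trim hm) with hB
  have hBA : B ≤ A := by
    apply lintegral_mono
    intro x
    have : t x ^ a = t x * t x ^ (a - 1) := by
      by_cases h0 : t x = 0
      · simp [h0, ha, show 0 < a by linarith]
      · nth_rewrite 2 [← ENNReal.rpow_one (t x)]
        rw [← ENNReal.rpow_add _ _ h0 (ne_top_of_le_ne_top hM (htM x))]
        congr 1; ring
    show q x * t x ^ a ≤ p x * t x ^ (a - 1)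
    rw [this, ← mul_assoc]
    exact mul_le_mul_left (htq x) _
  have hAt : A ≠ ∞ := by
    rw [hA, lintegral_rnDeriv_mul ((ac_left P Q).trim hm) ht1.aemeasurable]
    have : ∫⁻ x, t x ^ (a - 1) ∂(P.trim hm) ≤ ∫⁻ x, M ^ (a - 1) ∂(P.trim hm) :=
      lintegral_mono fun x => ENNReal.rpow_le_rpow (htM x) ha.le
    refine ne_top_of_le_ne_top ?_ this
    rw [lintegral_const]
    exact ENNReal.mul_ne_top (ENNReal.rpow_ne_top_of_nonneg ha.le hM) (measure_ne_top _ _)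
  have m1 : Measurable (fun x => P.rnDeriv ν x * t x ^ (a - 1)) :=
    (Measure.measurable_rnDeriv P ν).mul (ht1.mono hm le_rfl)
  have m2 : Measurable (fun x => Q.rnDeriv ν x * t x ^ a) :=
    (Measure.measurable_rnDeriv Q ν).mul (ht2.mono hm le_rfl)
  have main : ENNReal.ofReal a * A ≤ (∫⁻ x, P.rnDeriv ν x ^ a * Q.rnDeriv ν x ^ (1 - a) ∂ν)
      + ENNReal.ofReal (a - 1) * B := by
    rw [hA, hB, ← lint_trim hm P ν (ac_left P Q) _ ht1, ← lint_trim hm Q ν (ac_right P Q) _ ht2,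
      ← lintegral_const_mul _ m1, ← lintegral_const_mul _ m2,
      ← lintegral_add_right _ (m2.const_mul _)]
    apply lintegral_mono_ae
    filter_upwards [ae_props P Q] with x hx
    exact amgm_gt h1 _ _ _ (ne_top_of_le_ne_top (by simp) hx.1)
          (ne_top_of_le_ne_top (by simp) hx.2.1) (ne_top_of_le_ne_top hM (htM x))
  have hsplit : ENNReal.ofReal a = 1 + ENNReal.ofReal (a - 1) := by
    rw [← ENNReal.ofReal_one, ← ENNReal.ofReal_add (by norm_num) ha.le]; congr 1; ring
  rw [hsplit, add_mul, one_mul] at main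
  have main2 := main.trans (add_le_add_right (mul_le_mul_right hBA (ENNReal.ofReal (a - 1))) _)
  exact (ENNReal.add_le_add_iff_right (ENNReal.mul_ne_top (by simp) hAt)).1 main2

lemma dp_gt {X : Type*} {m mX : MeasurableSpace X} (hm : m ≤ mX) (P Q : Measure X)
    [IsFiniteMeasure P] [IsFiniteMeasure Q] {a : ℝ} (h1 : 1 < a) :
    @hellingerInt X m a (P.trim hm) (Q.trim hm) ≤ hellingerInt a P Q := by
  have ha : 0 < a - 1 := by linarith
  have aux := fun (n : ℕ) => dp_gt_aux hm P Q h1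
    (fun x => min ((P.trim hm).rnDeriv ((P + Q).trim hm) x / (Q.trim hm).rnDeriv ((P + Q).trim hm) x) n)
    (Measurable.min (Measurable.div (Measure.measurable_rnDeriv _ _) (Measure.measurable_rnDeriv _ _))
      measurable_const) n (by simp) (fun x => min_le_right _ _)
      (fun x => (mul_le_mul_right (min_le_left _ _) _).trans ENNReal.mul_div_le)
  have hprops := ae_props (P.trim hm) (Q.trim hm)
  have lem : ∀ u : ℕ → ℝ≥0∞, (∀ n, u n ≤ hellingerInt a P Q) →
      liminf u atTop ≤ hellingerInt a P Q := by
    intro u hu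
    refine liminf_le_of_le (by isBoundedDefault) (fun b hb => ?_)
    obtain ⟨n, hn⟩ := hb.exists
    exact hn.trans (hu n)
  refine le_trans ?_ (lem _ aux)
  clear lem aux
  unfold hellingerInt
  rw [← trim_add hm] at hprops ⊢
  set ν := P + Q with hν
  set p := @Measure.rnDeriv X m (P.trim hm) (ν.trim hm)
  set q := @Measure.rnDeriv X m (Q.trim hm) (ν.trim hm)
  have hp : Measurable[m] p := Measure.measurable_rnDeriv _ _
  have hq : Measurable[m] q := Measure.measurable_rnDeriv _ _
  refine le_trans ?_ (lintegral_liminf_le (fun n => ?_))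
  · apply lintegral_mono_ae
    filter_upwards [hprops] with x hx
    have hpt : p x ≠ ∞ := ne_top_of_le_ne_top (by simp) hx.1
    have hqt : q x ≠ ∞ := ne_top_of_le_ne_top (by simp) hx.2.1
    have hlim : Tendsto (fun n : ℕ => p x * (min (p x / q x) n) ^ (a - 1)) atTop
        (𝓝 (p x * (p x / q x) ^ (a - 1))) := by
      refine ENNReal.Tendsto.const_mul ?_ (Or.inr hpt)
      refine (ENNReal.continuous_rpow_const.tendsto _).comp ?_
      have : Tendsto (fun n : ℕ => min (p x / q x) (n : ℝ≥0∞)) atTop (𝓝 (min (p x / q x) ⊤)) :=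
        tendsto_const_nhds.min ENNReal.tendsto_nat_nhds_top
      simpa using this
    rw [hlim.liminf_eq]
    by_cases hp0 : p x = 0
    · simp [hp0, show 0 < a by linarith]
    by_cases hq0 : q x = 0
    · rw [hq0, ENNReal.div_zero hp0, ENNReal.top_rpow_of_pos ha, ENNReal.mul_top hp0]; exact le_top
    apply le_of_eq
    rw [div_eq_mul_inv, ENNReal.mul_rpow_of_ne_top hpt (by simpa using hq0), ← mul_assoc,
      ENNReal.inv_rpow, ← ENNReal.rpow_neg]
    nth_rewrite 2 [← ENNReal.rpow_one (p x)]
    rw [← ENNReal.rpow_add _ _ hp0 hpt]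
    congr 2 <;> ring
  · exact hp.mul (Measurable.pow_const (Measurable.min (Measurable.div hp hq) measurable_const) _)

/-- monotonicity in the order at the level of Hellinger integrals -/
lemma hell_mono {X : Type*} {mX : MeasurableSpace X} (P Q : Measure X)
    [IsProbabilityMeasure P] [IsProbabilityMeasure Q] {a b r : ℝ} (ha : 0 < a)
    (hr0 : 0 < r) (hr1 : r ≤ 1) (hr : r * (1 - b) = 1 - a) :
    hellingerInt a P Q ≤ hellingerInt b P Q ^ r := by
  unfold hellingerInt
  set ν := P + Q with hν
  set p := P.rnDeriv ν
  set q := Q.rnDeriv ν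
  have hp : Measurable p := Measure.measurable_rnDeriv _ _
  have hq : Measurable q := Measure.measurable_rnDeriv _ _
  have hint : ∫⁻ x, p x ∂ν = 1 := by
    rw [Measure.lintegral_rnDeriv (ac_left P Q)]; simp
  have key := ENNReal.lintegral_mul_norm_pow_le (μ := ν)
    (f := fun x => p x ^ b * q x ^ (1 - b)) (g := p)
    ((hp.pow_const _).mul (hq.pow_const _)).aemeasurable hp.aemeasurable hr0.le
    (sub_nonneg.2 hr1) (by ring)
  rw [hint, ENNReal.one_rpow, mul_one] at key
  refine le_trans (lintegral_mono_ae ?_) key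
  filter_upwards [ae_props P Q] with x hx
  have hpt : p x ≠ ∞ := ne_top_of_le_ne_top (by simp) hx.1
  by_cases hp0 : p x = 0
  · simp [hp0, ha]
  apply le_of_eq
  rw [ENNReal.mul_rpow_of_nonneg _ _ hr0.le, ← ENNReal.rpow_mul, ← ENNReal.rpow_mul, mul_right_comm,
    ← ENNReal.rpow_add _ _ hp0 hpt]
  congr 2
  · linarith
  · linarith


lemma rn_tendsto {X : Type*} {mX : MeasurableSpace X} (S ν : Measure X)
    [IsFiniteMeasure S] [IsFiniteMeasure ν] (h : S ≪ ν)
    (𝔉 : ℕ → MeasurableSpace X) (hmono : Monotone 𝔉) (hle : ∀ n, 𝔉 n ≤ mX) :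
    ∀ᵐ x ∂ν, Tendsto (fun n => (S.trim (hle n)).rnDeriv (ν.trim (hle n)) x) atTop
      (𝓝 ((S.trim (iSup_le hle)).rnDeriv (ν.trim (iSup_le hle)) x)) := by
  let ℱ : Filtration ℕ mX := ⟨𝔉, hmono, hle⟩
  have h1 := tendsto_ae_condExp (μ := ν) (ℱ := ℱ) (fun x => (S.rnDeriv ν x).toReal)
  have h2 : ∀ᵐ x ∂ν, ∀ n, (S.trim (hle n)).rnDeriv (ν.trim (hle n)) x
      = ENNReal.ofReal ((ν[fun x ↦ (S.rnDeriv ν x).toReal | 𝔉 n]) x) :=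
    ae_all_iff.2 fun n => ae_of_ae_trim (hle n) (rnDeriv_trim (hle n) h)
  have h3 := ae_of_ae_trim (iSup_le hle) (rnDeriv_trim (iSup_le hle) h)
  filter_upwards [h1, h2, h3] with x h1 h2 h3
  rw [h3]
  simp_rw [h2]
  exact (ENNReal.continuous_ofReal.tendsto _).comp h1

lemma hell_trim {X : Type*} {m mX : MeasurableSpace X} (hm : m ≤ mX) (P Q : Measure X) (a : ℝ) :
    @hellingerInt X m a (P.trim hm) (Q.trim hm)
      = ∫⁻ x, (P.trim hm).rnDeriv ((P + Q).trim hm) x ^ a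
        * (Q.trim hm).rnDeriv ((P + Q).trim hm) x ^ (1 - a) ∂(P + Q) := by
  unfold hellingerInt
  rw [← trim_add hm, lintegral_trim hm]
  exact ((Measure.measurable_rnDeriv _ _).pow_const _).mul ((Measure.measurable_rnDeriv _ _).pow_const _)

lemma ae_props_trim {X : Type*} {m mX : MeasurableSpace X} (hm : m ≤ mX) (P Q : Measure X)
    [IsFiniteMeasure P] [IsFiniteMeasure Q] :
    ∀ᵐ x ∂(P + Q), (P.trim hm).rnDeriv ((P + Q).trim hm) x ≤ 1 ∧
      (Q.trim hm).rnDeriv ((P + Q).trim hm) x ≤ 1 ∧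
      (P.trim hm).rnDeriv ((P + Q).trim hm) x + (Q.trim hm).rnDeriv ((P + Q).trim hm) x = 1 := by
  have := ae_props (P.trim hm) (Q.trim hm)
  rw [← trim_add hm] at this
  exact ae_of_ae_trim hm this

lemma meas_trim {X : Type*} {m mX : MeasurableSpace X} (hm : m ≤ mX) (P Q ν : Measure X) (a b : ℝ) :
    Measurable (fun x => (P.trim hm).rnDeriv (ν.trim hm) x ^ a
        * (Q.trim hm).rnDeriv (ν.trim hm) x ^ b) :=
  (((Measure.measurable_rnDeriv _ _).mono hm le_rfl).pow_const _).mul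
    (((Measure.measurable_rnDeriv _ _).mono hm le_rfl).pow_const _)

lemma integrand_tendsto {X : Type*} {mX : MeasurableSpace X} (P Q : Measure X)
    [IsFiniteMeasure P] [IsFiniteMeasure Q]
    (𝔉 : ℕ → MeasurableSpace X) (hmono : Monotone 𝔉) (hle : ∀ n, 𝔉 n ≤ mX) {a : ℝ} (ha : 0 < a) :
    ∀ᵐ x ∂(P + Q), Tendsto (fun n => (P.trim (hle n)).rnDeriv ((P + Q).trim (hle n)) x ^ a
        * (Q.trim (hle n)).rnDeriv ((P + Q).trim (hle n)) x ^ (1 - a)) atTop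
      (𝓝 ((P.trim (iSup_le hle)).rnDeriv ((P + Q).trim (iSup_le hle)) x ^ a
        * (Q.trim (iSup_le hle)).rnDeriv ((P + Q).trim (iSup_le hle)) x ^ (1 - a))) := by
  filter_upwards [rn_tendsto P (P + Q) (ac_left P Q) 𝔉 hmono hle,
    rn_tendsto Q (P + Q) (ac_right P Q) 𝔉 hmono hle, ae_props_trim (iSup_le hle) P Q] with x h1 h2 h3
  refine ENNReal.Tendsto.mul ((ENNReal.continuous_rpow_const.tendsto _).comp h1) ?_
    ((ENNReal.continuous_rpow_const.tendsto _).comp h2) ?_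
  · by_cases hp0 : (P.trim (iSup_le hle)).rnDeriv ((P + Q).trim (iSup_le hle)) x = 0
    · right
      rw [hp0, zero_add] at h3
      rw [h3.2.2]; simp
    · left
      simp [hp0, ha.not_gt]
  · right
    exact ENNReal.rpow_ne_top_of_nonneg ha.le (ne_top_of_le_ne_top (by simp) h3.1)

lemma hell_tendsto {X : Type*} {mX : MeasurableSpace X} (P Q : Measure X)
    [IsFiniteMeasure P] [IsFiniteMeasure Q]
    (𝔉 : ℕ → MeasurableSpace X) (hmono : Monotone 𝔉) (hle : ∀ n, 𝔉 n ≤ mX) {a : ℝ} (ha : 0 < a)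
    (ha1 : a ≠ 1) :
    Tendsto (fun n => @hellingerInt X (𝔉 n) a (P.trim (hle n)) (Q.trim (hle n))) atTop
      (𝓝 (@hellingerInt X (⨆ n, 𝔉 n) a (P.trim (iSup_le hle)) (Q.trim (iSup_le hle)))) := by
  have hI := integrand_tendsto P Q 𝔉 hmono hle ha
  rcases lt_or_gt_of_ne ha1 with h | h
  · simp_rw [hell_trim]
    refine tendsto_lintegral_of_dominated_convergence (fun _ => 1)
      (fun n => meas_trim (hle n) P Q (P + Q) _ _) (fun n => ?_) (by simp) hI
    filter_upwards [ae_props_trim (hle n) P Q] with x hx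
    exact mul_le_one' (ENNReal.rpow_le_one hx.1 ha.le) (ENNReal.rpow_le_one hx.2.1 (by linarith))
  · refine tendsto_of_le_liminf_of_limsup_le ?_ ?_
    · simp_rw [hell_trim]
      refine le_trans (le_of_eq ?_) (lintegral_liminf_le fun n => meas_trim (hle n) P Q (P + Q) _ _)
      apply lintegral_congr_ae
      filter_upwards [hI] with x hx
      exact hx.liminf_eq.symm
    · refine limsup_le_of_le (by isBoundedDefault) (Eventually.of_forall fun n => ?_)
      have := @dp_gt X (𝔉 n) (⨆ n, 𝔉 n) (le_iSup 𝔉 n) (P.trim (iSup_le hle)) (Q.trim (iSup_le hle))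
        inferInstance inferInstance a h
      rwa [trim_trim, trim_trim] at this

lemma simple_tendsto {X : Type*} {mX : MeasurableSpace X} (P Q : Measure X)
    [IsFiniteMeasure P] [IsFiniteMeasure Q]
    (𝔉 : ℕ → MeasurableSpace X) (hmono : Monotone 𝔉) (hle : ∀ n, 𝔉 n ≤ mX) {a : ℝ} (ha : 0 < a)
    (ha1 : a ≠ 1) :
    Tendsto (fun n => @renyiSimple X (𝔉 n) a (P.trim (hle n)) (Q.trim (hle n))) atTop
      (𝓝 (@renyiSimple X (⨆ n, 𝔉 n) a (P.trim (iSup_le hle)) (Q.trim (iSup_le hle)))) := by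
  unfold renyiSimple
  exact EReal.Tendsto.const_mul
    ((ENNReal.continuous_log.tendsto _).comp (hell_tendsto P Q 𝔉 hmono hle ha ha1))
    (Or.inl (EReal.coe_ne_bot _)) (Or.inl (EReal.coe_ne_top _))

lemma simple_dp {X : Type*} {m mX : MeasurableSpace X} (hm : m ≤ mX) (P Q : Measure X)
    [IsFiniteMeasure P] [IsFiniteMeasure Q] {a : ℝ} (ha : 0 < a) (ha1 : a ≠ 1) :
    @renyiSimple X m a (P.trim hm) (Q.trim hm) ≤ renyiSimple a P Q := by
  unfold renyiSimple
  rcases lt_or_gt_of_ne ha1 with h | h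
  · have : (((a - 1)⁻¹ : ℝ) : EReal) ≤ 0 := by
      exact_mod_cast inv_nonpos.2 (by linarith)
    rw [mul_comm, mul_comm _ (ENNReal.log _)]
    exact EReal.mul_le_mul_of_nonpos_right (ENNReal.log_le_log (dp_lt hm P Q ha h)) this
  · have : 0 ≤ (((a - 1)⁻¹ : ℝ) : EReal) := by
      exact_mod_cast inv_nonneg.2 (by linarith)
    exact mul_le_mul_of_nonneg_left (ENNReal.log_le_log (dp_gt hm P Q h)) this

lemma simple_mono_lt {X : Type*} {mX : MeasurableSpace X} (P Q : Measure X)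
    [IsProbabilityMeasure P] [IsProbabilityMeasure Q] {a b : ℝ} (ha : 0 < a) (hab : a ≤ b)
    (hb : b < 1) : renyiSimple a P Q ≤ renyiSimple b P Q := by
  unfold renyiSimple
  have hb' : 0 < 1 - b := by linarith
  have ha' : 0 < 1 - a := by linarith
  have h := hell_mono P Q (a := b) (b := a) (r := (1 - b) / (1 - a)) (by linarith)
    (by positivity) ((div_le_one ha').2 (by linarith)) (by field_simp)
  have h2 := ENNReal.log_le_log h
  rw [ENNReal.log_rpow] at h2
  have hneg : (((b - 1)⁻¹ : ℝ) : EReal) ≤ 0 := by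
    exact_mod_cast inv_nonpos.2 (by linarith)
  have h3 := EReal.mul_le_mul_of_nonpos_right h2 hneg
  rw [mul_comm, mul_comm _ (((b - 1)⁻¹ : ℝ) : EReal), ← mul_assoc, ← EReal.coe_mul] at h3
  convert h3 using 3
  have : a - 1 ≠ 0 := by linarith
  have : b - 1 ≠ 0 := by linarith
  field_simp
  ring

lemma simple_mono_gt {X : Type*} {mX : MeasurableSpace X} (P Q : Measure X)
    [IsProbabilityMeasure P] [IsProbabilityMeasure Q] {a b : ℝ} (ha : 1 < a) (hab : a ≤ b) :
    renyiSimple a P Q ≤ renyiSimple b P Q := by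
  unfold renyiSimple
  have hb' : 0 < b - 1 := by linarith
  have ha' : 0 < a - 1 := by linarith
  have h := hell_mono P Q (a := a) (b := b) (r := (a - 1) / (b - 1)) (by linarith)
    (by positivity) ((div_le_one hb').2 (by linarith)) (by field_simp; ring)
  have h2 := ENNReal.log_le_log h
  rw [ENNReal.log_rpow] at h2
  have hpos : 0 ≤ (((a - 1)⁻¹ : ℝ) : EReal) := by
    exact_mod_cast inv_nonneg.2 ha'.le
  have h3 := mul_le_mul_of_nonneg_left h2 hpos
  rw [← mul_assoc, ← EReal.coe_mul] at h3
  convert h3 using 3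
  field_simp

/-- abstract exchange of limits -/
lemma exchange (l : Filter ℝ) [l.NeBot] (S : Set ℝ) (hS : S ∈ l) (hS2 : ∀ a ∈ S, ∀ᶠ b in l, a ≤ b)
    (u : ℕ → ℝ → EReal) (v : ℝ → EReal)
    (hmono : ∀ n, ∀ a ∈ S, ∀ b ∈ S, a ≤ b → u n a ≤ u n b)
    (hle : ∀ n, ∀ a ∈ S, u n a ≤ v a)
    (hlim : ∀ a ∈ S, Tendsto (fun n => u n a) atTop (𝓝 (v a))) :
    Tendsto (fun n => limsup (u n) l) atTop (𝓝 (limsup v l)) := by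
  refine tendsto_of_le_liminf_of_limsup_le ?_ ?_
  · refine limsup_le_of_le (by isBoundedDefault) ?_
    filter_upwards [hS] with a ha
    rw [← (hlim a ha).liminf_eq]
    refine liminf_le_liminf (Eventually.of_forall fun n => ?_)
    refine le_limsup_of_frequently_le (Eventually.frequently ?_) (by isBoundedDefault)
    filter_upwards [hS, hS2 a ha] with b hb hab
    exact hmono n a ha b hb hab
  · refine limsup_le_of_le (by isBoundedDefault) (Eventually.of_forall fun n => ?_)
    refine limsup_le_limsup ?_
    filter_upwards [hS] with a ha using hle n a ha

/-- **Increasing limits of σ-algebras.** If `𝔉 0 ≤ 𝔉 1 ≤ ⋯ ≤ mX` is an increasing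
family of sub-σ-algebras and `⨆ n, 𝔉 n` is the smallest σ-algebra containing all of
them, then for every order `α ∈ (0,∞]`,
`D_α(P|𝔉 n ‖ Q|𝔉 n) → D_α(P|⨆ n, 𝔉 n ‖ Q|⨆ n, 𝔉 n)` as `n → ∞`. -/
theorem renyiDiv_tendsto_of_increasing_sigma_algebras
    {X : Type*} {mX : MeasurableSpace X} (P Q : Measure X)
    [IsProbabilityMeasure P] [IsProbabilityMeasure Q]
    (𝔉 : ℕ → MeasurableSpace X) (hmono : Monotone 𝔉) (hle : ∀ n, 𝔉 n ≤ mX)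
    (α : ℝ≥0∞) (hα : α ≠ 0) :
    Tendsto
      (fun n => @renyiDiv X (𝔉 n) α
        (@Measure.trim X (𝔉 n) mX P (hle n)) (@Measure.trim X (𝔉 n) mX Q (hle n)))
      atTop
      (nhds (@renyiDiv X (⨆ n, 𝔉 n) α
        (@Measure.trim X (⨆ n, 𝔉 n) mX P (iSup_le hle))
        (@Measure.trim X (⨆ n, 𝔉 n) mX Q (iSup_le hle)))) := by
  have hdp : ∀ n, ∀ a : ℝ, 0 < a → a ≠ 1 →
      @renyiSimple X (𝔉 n) a (P.trim (hle n)) (Q.trim (hle n)) ≤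
      @renyiSimple X (⨆ n, 𝔉 n) a (P.trim (iSup_le hle)) (Q.trim (iSup_le hle)) := by
    intro n a h0 h1
    have := @simple_dp X (𝔉 n) (⨆ n, 𝔉 n) (le_iSup 𝔉 n) (P.trim (iSup_le hle))
      (Q.trim (iSup_le hle)) inferInstance inferInstance a h0 h1
    rwa [trim_trim, trim_trim] at this
  have hPn : ∀ n, IsProbabilityMeasure (P.trim (hle n)) := fun n =>
    ⟨by rw [trim_measurableSet_eq (hle n) MeasurableSet.univ]; simp⟩
  have hQn : ∀ n, IsProbabilityMeasure (Q.trim (hle n)) := fun n =>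
    ⟨by rw [trim_measurableSet_eq (hle n) MeasurableSet.univ]; simp⟩
  unfold renyiDiv
  simp only [hα, if_false]
  by_cases h1 : α = 1
  · simp only [h1, if_true]
    refine exchange _ (Set.Ioo 0 1) (Ioo_mem_nhdsLT one_pos) (fun a ha => ?_) _ _
      (fun n a ha b hb hab => ?_) (fun n a ha => hdp n a ha.1 ha.2.ne)
      (fun a ha => simple_tendsto P Q 𝔉 hmono hle ha.1 ha.2.ne)
    · filter_upwards [Ioo_mem_nhdsLT ha.2] with b hb using hb.1.le
    · exact simple_mono_lt _ _ ha.1 hab hb.2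
  by_cases h2 : α = ∞
  · simp only [h2, if_true, ENNReal.top_ne_one, if_false]
    refine exchange _ (Set.Ioi 1) (Ioi_mem_atTop 1) (fun a ha => eventually_ge_atTop a) _ _
      (fun n a ha b hb hab => ?_) (fun n a ha => hdp n a (one_pos.trans ha) (ne_of_gt ha))
      (fun a ha => simple_tendsto P Q 𝔉 hmono hle (one_pos.trans ha) (ne_of_gt ha))
    exact simple_mono_gt _ _ ha hab
  · simp only [h1, h2, if_false]
    refine simple_tendsto P Q 𝔉 hmono hle (ENNReal.toReal_pos hα h2) ?_
    intro h
    exact h1 ((ENNReal.toReal_eq_one_iff α).1 h)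
end
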